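/- Let 0 ≤ d ≤ n and r = n + 1 − d ≥ 1. Let f be holomorphic near 0 in ℂ^{n+1} with f(0) = 0, and let g₁,…,g_r be holomorphic near 0 with g_i(0) = 0, generating an ideal I of O_{n+1} such that O_{n+1}/I is reduced and has Krull dimension d (I defines a complete intersection Σ^d at 0 with reduced structure). Suppose the jacobian ideal satisfies J(f) = I (equivalently J(f) ⊆ I and j(f) = dim_ℂ I/J(f) = 0). Then f has a singularity of type A(d) at 0: there is a biholomorphism φ from a neighborhood of 0 in ℂ^d × ℂ^r onto a neighborhood of 0 in ℂ^{n+1} with φ(0) = 0 and f(φ(z,w)) = w₁² + ⋯ + w_r² for all (z,w) in that neighborhood. (Lemma 4.4 of the paper.) -/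

import Mathlib

open Filter Topology

set_option maxHeartbeats 1000000
set_option synthInstance.maxHeartbeats 400000

noncomputable section

/-- `ℂⁿ`. -/
abbrev Cn (n : ℕ) : Type := Fin n → ℂ

/-- `Filter.Germ l ℂ` is a `ℂ`-algebra via constant germs. -/
instance germAlgebra {α : Type*} (l : Filter α) : Algebra ℂ (Filter.Germ l ℂ) :=
  ((Filter.Germ.coeRingHom l).comp (Pi.constRingHom α ℂ)).toAlgebra

/-- The local ring `O_n` of germs at `0` of holomorphic functions `ℂⁿ → ℂ`,
realized as the subalgebra of `Filter.Germ (𝓝 0) ℂ` consisting of germs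
having a representative analytic on a neighborhood of `0`. -/
def On (n : ℕ) : Subalgebra ℂ (Filter.Germ (𝓝 (0 : Cn n)) ℂ) where
  carrier := {φ | ∃ f : Cn n → ℂ, AnalyticAt ℂ f 0 ∧ φ = ↑f}
  mul_mem' := by
    rintro a b ⟨f, hf, rfl⟩ ⟨g, hg, rfl⟩
    exact ⟨f * g, hf.mul hg, rfl⟩
  one_mem' := ⟨1, analyticAt_const, rfl⟩
  add_mem' := by
    rintro a b ⟨f, hf, rfl⟩ ⟨g, hg, rfl⟩
    exact ⟨f + g, hf.add hg, rfl⟩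
  zero_mem' := ⟨0, analyticAt_const, rfl⟩
  algebraMap_mem' := fun c => ⟨fun _ => c, analyticAt_const, rfl⟩

/-- The ideal of `O_n` generated by the germs at `0` of a set of functions. -/
def idealOfFuns {n : ℕ} (s : Set (Cn n → ℂ)) : Ideal (On n) :=
  Ideal.span {x : On n | ∃ f ∈ s, (x : Filter.Germ (𝓝 (0 : Cn n)) ℂ) = ↑f}

/-- The `i`-th partial derivative `∂f/∂zᵢ` of `f : ℂⁿ → ℂ`. -/
def pder {n : ℕ} (f : Cn n → ℂ) (i : Fin n) : Cn n → ℂ :=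
  fun z => fderiv ℂ f z (Pi.single i 1)

/-- The jacobian ideal `J(f)` of `O_n`, generated by the germs at `0` of the
partial derivatives of `f`. -/
def jacobianIdeal {n : ℕ} (f : Cn n → ℂ) : Ideal (On n) :=
  idealOfFuns (Set.range (pder f))

/-- For ideals `J ⊆ I` of `O_n`, the quotient `I/J`, realized as the
`ℂ`-subspace of `O_n ⧸ J` given by the image of `I`. -/
def quotIJ {n : ℕ} (I J : Ideal (On n)) : Submodule ℂ ((On n) ⧸ J) :=
  (I.map (Ideal.Quotient.mk J)).restrictScalars ℂ

/-- `f` has a singularity of type `A(d)` at `x ∈ ℂⁿ` (with `r = n - d`):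
there is a biholomorphism `φ` from a neighborhood of `0` in `ℂ^d × ℂ^r` onto a
neighborhood of `x` with `φ 0 = x` and `f (φ (z, w)) - f x = w₁² + ⋯ + w_r²`. -/
def HasAdSingularityAt (n d r : ℕ) (f : Cn n → ℂ) (x : Cn n) : Prop :=
  ∃ (V : Set ((Fin d → ℂ) × (Fin r → ℂ))) (W : Set (Cn n))
    (φ : (Fin d → ℂ) × (Fin r → ℂ) → Cn n) (ψ : Cn n → (Fin d → ℂ) × (Fin r → ℂ)),
    IsOpen V ∧ IsOpen W ∧ (0 : (Fin d → ℂ) × (Fin r → ℂ)) ∈ V ∧ x ∈ W ∧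
    φ 0 = x ∧ AnalyticOnNhd ℂ φ V ∧ AnalyticOnNhd ℂ ψ W ∧
    Set.MapsTo φ V W ∧ Set.MapsTo ψ W V ∧
    (∀ q ∈ V, ψ (φ q) = q) ∧ (∀ y ∈ W, φ (ψ y) = y) ∧
    ∀ q ∈ V, f (φ q) - f x = ∑ i, (q.2 i) ^ 2

section DifferentialCore

variable {k O : Type*} [Field k] [CommRing O] [Algebra k O]

theorem Derivation.iterate_mul (D : Derivation k O O) (n : ℕ) (a b : O) :
    D^[n] (a * b) =
      ∑ ij ∈ Finset.HasAntidiagonal.antidiagonal n, (n.choose ij.1 : O) * (D^[ij.1] a * D^[ij.2] b) := by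
  induction n with
  | zero => simp
  | succ n ih =>
    rw [Finset.sum_antidiagonal_choose_succ_mul (fun i j => D^[i] a * D^[j] b),
      Function.iterate_succ_apply', ih, map_sum, ← Finset.sum_add_distrib]
    refine Finset.sum_congr rfl fun ij _ => ?_
    simp only [Derivation.leibniz, Function.iterate_succ_apply', smul_eq_mul,
      Derivation.map_natCast, mul_zero, add_zero]
    rw [Nat.choose_symm_of_eq_add]
    · ring
    · simp_all

/-- The largest `D`-stable ideal contained in `p`. -/
def Derivation.core (D : Derivation k O O) (p : Ideal O) : Ideal O where
  carrier := {a | ∀ i, D^[i] a ∈ p}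
  add_mem' ha hb i := by
    rw [iterate_map_add]; exact p.add_mem (ha i) (hb i)
  zero_mem' i := by
    rw [iterate_map_zero]; exact p.zero_mem
  smul_mem' c x hx i := by
    rw [smul_eq_mul, D.iterate_mul]
    exact p.sum_mem fun ij _ => p.mul_mem_left _ (p.mul_mem_left _ (hx _))

namespace Derivation

variable (D : Derivation k O O) {p q : Ideal O}

theorem mem_core {a : O} : a ∈ D.core p ↔ ∀ i, D^[i] a ∈ p := Iff.rfl

theorem core_le : D.core p ≤ p := fun _ ha => ha 0

theorem core_mono (h : p ≤ q) : D.core p ≤ D.core q := fun _ ha i => h (ha i)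

theorem le_core {K : Ideal O} (hKp : K ≤ p) (hK : ∀ a ∈ K, D a ∈ K) : K ≤ D.core p := by
  intro a ha i
  refine hKp ?_
  induction i with
  | zero => exact ha
  | succ i ih => rw [Function.iterate_succ_apply']; exact hK _ ih

/-- Successive cores of `p` for a sequence of derivations. -/
def iterCore (D : ℕ → Derivation k O O) (p : Ideal O) : ℕ → Ideal O
  | 0 => p
  | j + 1 => (D j).core (iterCore D p j)

variable {D : ℕ → Derivation k O O}

theorem iterCore_le (j : ℕ) : iterCore D p j ≤ p := by
  induction j with
  | zero => exact le_rfl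
  | succ j ih => exact (D j).core_le.trans ih

theorem iterCore_mono (h : p ≤ q) (j : ℕ) : iterCore D p j ≤ iterCore D q j := by
  induction j with
  | zero => exact h
  | succ j ih => exact (D j).core_mono ih

theorem le_iterCore {d : ℕ} {K : Ideal O} (hKp : K ≤ p) (hK : ∀ j < d, ∀ a ∈ K, D j a ∈ K) :
    ∀ j ≤ d, K ≤ iterCore D p j := by
  intro j
  induction j with
  | zero => exact fun _ => hKp
  | succ j ih => exact fun hj => (D j).le_core (ih (by omega)) (hK j (by omega))

theorem mem_iterCore {d : ℕ} {t : ℕ → O} (ht : ∀ j < d, t j ∈ p)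
    (hDt : ∀ i < d, ∀ j < d, D i (t j) = if i = j then 1 else 0) :
    ∀ j ≤ d, ∀ l < d, j ≤ l → t l ∈ iterCore D p j := by
  intro j
  induction j with
  | zero => exact fun _ l hl _ => ht l hl
  | succ j ih =>
    intro hj l hl hjl i
    cases i with
    | zero => exact ih (by omega) l hl (by omega)
    | succ i =>
      rw [Function.iterate_succ_apply, hDt j (by omega) l hl, if_neg (by omega),
        iterate_map_zero]
      exact Ideal.zero_mem _

variable [CharZero k]

theorem core_isPrime (D : Derivation k O O) (hp : p.IsPrime) : (D.core p).IsPrime := by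
  classical
  refine Ideal.isPrime_iff.2 ⟨fun h => hp.ne_top (top_le_iff.1 (h ▸ D.core_le)), ?_⟩
  intro a b hab
  by_contra! hcon
  obtain ⟨ha, hb⟩ := hcon
  have ha' : ∃ i, D^[i] a ∉ p := by simpa [mem_core] using ha
  have hb' : ∃ i, D^[i] b ∉ p := by simpa [mem_core] using hb
  set i := Nat.find ha'
  set j := Nat.find hb'
  have h := hab (i + j)
  rw [D.iterate_mul, ← Finset.add_sum_erase _ _ (a := (i, j)) (by simp)] at h
  have hrest : ∑ x ∈ (Finset.HasAntidiagonal.antidiagonal (i + j)).erase (i, j),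
      ((i + j).choose x.1 : O) * (D^[x.1] a * D^[x.2] b) ∈ p := by
    refine p.sum_mem fun x hx => p.mul_mem_left _ ?_
    rw [Finset.mem_erase, Finset.HasAntidiagonal.mem_antidiagonal] at hx
    rcases lt_or_ge x.1 i with hlt | hge
    · exact p.mul_mem_right _ (not_not.1 (Nat.find_min ha' hlt))
    · refine p.mul_mem_left _ (not_not.1 (Nat.find_min hb' ?_))
      have : x.1 ≠ i := fun h1 => hx.1 (Prod.ext h1 (by simp only; omega))
      change x.2 < j
      omega
  have h2 := (p.add_mem_iff_left hrest).1 h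
  have hunit : IsUnit ((i + j).choose i : O) := by
    have : ((i + j).choose i : O) = algebraMap k O ((i + j).choose i) := by simp
    rw [this]
    refine IsUnit.map _ (IsUnit.mk0 _ ?_)
    exact_mod_cast (Nat.choose_pos (Nat.le_add_right i j)).ne'
  rw [Ideal.unit_mul_mem_iff_mem _ hunit] at h2
  rcases hp.mem_or_mem h2 with h3 | h3
  · exact Nat.find_spec ha' h3
  · exact Nat.find_spec hb' h3

theorem iterCore_isPrime (hp : p.IsPrime) (j : ℕ) : (iterCore D p j).IsPrime := by
  induction j with
  | zero => exact hp
  | succ j ih => exact (D j).core_isPrime ih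

theorem notMem_iterCore {d : ℕ} {t : ℕ → O} (hp : p.IsPrime)
    (hDt : ∀ i < d, ∀ j < d, D i (t j) = if i = j then 1 else 0) {j : ℕ} (hj : j < d) :
    t j ∉ iterCore D p (j + 1) := by
  intro h
  have h1 := h 1
  rw [Function.iterate_one, hDt j hj j hj, if_pos rfl] at h1
  exact (iterCore_isPrime hp j).ne_top ((Ideal.eq_top_iff_one _).2 h1)

theorem le_coheight_iterCore {d : ℕ} {t : ℕ → O} (hp : p.IsPrime) (ht : ∀ j < d, t j ∈ p)
    (hDt : ∀ i < d, ∀ j < d, D i (t j) = if i = j then 1 else 0) {I : Ideal O} (hIp : I ≤ p)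
    (hI : ∀ j < d, ∀ a ∈ I, D j a ∈ I) :
    ∀ j, ∀ hj : j ≤ d, (j : ℕ∞) ≤ Order.coheight
      (⟨⟨iterCore D p j, iterCore_isPrime hp j⟩, le_iterCore hIp hI j hj⟩ :
        PrimeSpectrum.zeroLocus (I : Set O)) := by
  intro j
  induction j with
  | zero => simp
  | succ j ih =>
    intro hj
    push_cast
    refine (add_le_add_left (ih (by omega)) 1).trans (Order.coheight_add_one_le ?_)
    refine lt_of_le_of_ne (D j).core_le fun h => ?_
    have h' : iterCore D p (j + 1) = iterCore D p j :=
      congrArg (fun x : PrimeSpectrum.zeroLocus (I : Set O) => x.1.asIdeal) h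
    refine notMem_iterCore hp hDt (show j < d by omega) ?_
    rw [h']
    exact mem_iterCore ht hDt j (by omega) j (by omega) le_rfl

theorem le_ringKrullDim_quotient {d : ℕ} {t : ℕ → O} (hp : p.IsPrime) (ht : ∀ j < d, t j ∈ p)
    (hDt : ∀ i < d, ∀ j < d, D i (t j) = if i = j then 1 else 0) {I : Ideal O} (hIp : I ≤ p)
    (hI : ∀ j < d, ∀ a ∈ I, D j a ∈ I) : (d : WithBot ℕ∞) ≤ ringKrullDim (O ⧸ I) := by
  rw [ringKrullDim_quotient]
  refine le_trans ?_ (Order.coheight_le_krullDim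
    ⟨⟨iterCore D p d, iterCore_isPrime hp d⟩, le_iterCore hIp hI d le_rfl⟩)
  exact_mod_cast le_coheight_iterCore hp ht hDt hIp hI d le_rfl

theorem stable_le_of_isRadical [IsLocalRing O] {d : ℕ} {t : ℕ → O}
    (ht : ∀ j < d, t j ∈ IsLocalRing.maximalIdeal O)
    (hDt : ∀ i < d, ∀ j < d, D i (t j) = if i = j then 1 else 0)
    {I : Ideal O} (hIr : I.IsRadical) (hI1 : I ≤ IsLocalRing.maximalIdeal O)
    (hI : ∀ j < d, ∀ a ∈ I, D j a ∈ I) (hdim : ringKrullDim (O ⧸ I) ≤ d)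
    {K : Ideal O} (hK1 : K ≤ IsLocalRing.maximalIdeal O) (hK : ∀ j < d, ∀ a ∈ K, D j a ∈ K) :
    K ≤ I := by
  have hm : (IsLocalRing.maximalIdeal O).IsPrime := inferInstance
  refine (le_iterCore hK1 hK d le_rfl).trans ?_
  rw [← hIr.radical, Ideal.radical_eq_sInf]
  refine le_sInf ?_
  rintro q ⟨hIq, hq⟩
  by_contra hcon
  have hle : iterCore D q d ≤ iterCore D (IsLocalRing.maximalIdeal O) d :=
    iterCore_mono (IsLocalRing.le_maximalIdeal hq.ne_top) d
  let x : PrimeSpectrum.zeroLocus (I : Set O) :=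
    ⟨⟨iterCore D _ d, iterCore_isPrime hm d⟩, le_iterCore hI1 hI d le_rfl⟩
  let y : PrimeSpectrum.zeroLocus (I : Set O) :=
    ⟨⟨iterCore D q d, iterCore_isPrime hq d⟩, le_iterCore hIq hI d le_rfl⟩
  have hyx : y < x := by
    refine lt_of_le_of_ne hle fun h => hcon ?_
    have h' : iterCore D q d = iterCore D (IsLocalRing.maximalIdeal O) d :=
      congrArg (fun x : PrimeSpectrum.zeroLocus (I : Set O) => x.1.asIdeal) h
    rw [← h']
    exact iterCore_le d
  have h1 : (d : ℕ∞) + 1 ≤ Order.coheight y :=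
    (add_le_add_left (le_coheight_iterCore hm ht hDt hI1 hI d le_rfl) 1).trans
      (Order.coheight_add_one_le hyx)
  have h2 : ((d + 1 : ℕ) : WithBot ℕ∞) ≤ d := by
    refine le_trans ?_ ((Order.coheight_le_krullDim y).trans
      ((ringKrullDim_quotient I).symm.le.trans hdim))
    exact_mod_cast h1
  have h3 : d + 1 ≤ d := by exact_mod_cast h2
  omega

end Derivation

end DifferentialCore

section FiniteFamilies

namespace Derivation

variable {k O κ : Type*} [Field k] [CommRing O] [Algebra k O]
  [Finite κ] [DecidableEq κ] {D : κ → Derivation k O O} {t : κ → O} {I : Ideal O}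

theorem exists_nat_family (hDt : ∀ i j, D i (t j) = if i = j then 1 else 0) :
    ∃ (D' : ℕ → Derivation k O O) (t' : ℕ → O),
      (∀ i < Nat.card κ, ∃ a, D' i = D a ∧ t' i = t a) ∧
      ∀ i < Nat.card κ, ∀ j < Nat.card κ, D' i (t' j) = if i = j then 1 else 0 := by
  let e := Finite.equivFin κ
  refine ⟨fun n => if h : n < Nat.card κ then D (e.symm ⟨n, h⟩) else 0,
    fun n => if h : n < Nat.card κ then t (e.symm ⟨n, h⟩) else 0, fun i hi => ?_,
    fun i hi j hj => ?_⟩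
  · exact ⟨e.symm ⟨i, hi⟩, by simp [hi], by simp [hi]⟩
  · simp [hi, hj, hDt]

variable [CharZero k]

theorem natCard_le_ringKrullDim_quotient {p : Ideal O} (hp : p.IsPrime) (ht : ∀ j, t j ∈ p)
    (hDt : ∀ i j, D i (t j) = if i = j then 1 else 0) (hIp : I ≤ p)
    (hI : ∀ j, ∀ a ∈ I, D j a ∈ I) : (Nat.card κ : WithBot ℕ∞) ≤ ringKrullDim (O ⧸ I) := by
  obtain ⟨D', t', h1, h2⟩ := exists_nat_family hDt
  refine le_ringKrullDim_quotient hp (fun j hj => ?_) h2 hIp (fun j hj => ?_)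
  · obtain ⟨a, -, h⟩ := h1 j hj
    exact h ▸ ht a
  · obtain ⟨a, h, -⟩ := h1 j hj
    exact h ▸ hI a

theorem le_of_stable_of_ringKrullDim_le [IsLocalRing O]
    (ht : ∀ j, t j ∈ IsLocalRing.maximalIdeal O)
    (hDt : ∀ i j, D i (t j) = if i = j then 1 else 0)
    (hIr : I.IsRadical) (hI1 : I ≤ IsLocalRing.maximalIdeal O)
    (hI : ∀ j, ∀ a ∈ I, D j a ∈ I) (hdim : ringKrullDim (O ⧸ I) ≤ Nat.card κ)
    {K : Ideal O} (hK1 : K ≤ IsLocalRing.maximalIdeal O) (hK : ∀ j, ∀ a ∈ K, D j a ∈ K) :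
    K ≤ I := by
  obtain ⟨D', t', h1, h2⟩ := exists_nat_family hDt
  refine stable_le_of_isRadical (D := D') (t := t') (fun j hj => ?_) h2 hIr hI1 (fun j hj => ?_)
    hdim hK1 (fun j hj => ?_)
  · obtain ⟨a, -, h⟩ := h1 j hj
    exact h ▸ ht a
  · obtain ⟨a, h, -⟩ := h1 j hj
    exact h ▸ hI a
  · obtain ⟨a, h, -⟩ := h1 j hj
    exact h ▸ hK a

end Derivation

end FiniteFamilies

section LinearAlgebra

variable {k ι : Type*} [Field k]

/-- If a set of rows of a symmetric matrix is a basis of the row space, then the corresponding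
principal minor does not vanish. -/
theorem Matrix.det_submatrix_ne_zero_of_isSymm (H : Matrix ι ι k) (hH : H.IsSymm)
    (T : Finset ι) [DecidableEq T] (hT : LinearIndepOn k H.row (T : Set ι)) (c : ι → T → k)
    (hc : ∀ i j, H i j = ∑ l, c i l * H l j) :
    (H.submatrix (fun i : T => (i : ι)) (fun i : T => (i : ι))).det ≠ 0 := by
  intro h0
  obtain ⟨x, hx0, hx⟩ := Matrix.exists_vecMul_eq_zero_iff.2 h0
  refine hx0 ?_
  have hli : LinearIndependent k (fun i : T => H.row i) := hT
  rw [Fintype.linearIndependent_iff] at hli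
  refine funext (hli x ?_)
  ext j
  have hx' : ∀ l' : T, ∑ l : T, x l * H l l' = 0 := fun l' => congrFun hx l'
  calc (∑ l : T, x l • H.row l) j = ∑ l : T, x l * H l j := by simp [Matrix.row]
    _ = ∑ l : T, ∑ l' : T, c j l' * (x l * H l l') := by
        refine Finset.sum_congr rfl fun l _ => ?_
        rw [← hH.apply l j, hc j l, Finset.mul_sum]
        refine Finset.sum_congr rfl fun l' _ => ?_
        rw [← hH.apply l l']
        ring
    _ = 0 := by
        rw [Finset.sum_comm]
        simp only [← Finset.mul_sum, hx', mul_zero, Finset.sum_const_zero]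

end LinearAlgebra

section JacobianIdeal

variable {k O ι : Type*} [Field k] [CommRing O] [Algebra k O] [Fintype ι]

/-- The derivation `∑ vᵢ ∂ᵢ`. -/
def Derivation.ofVec (δ : ι → Derivation k O O) (v : ι → O) : Derivation k O O :=
  ∑ i, v i • δ i

namespace Derivation

variable {δ : ι → Derivation k O O}

theorem ofVec_apply (v : ι → O) (a : O) : ofVec δ v a = ∑ i, v i * δ i a := by
  have h : ∀ s : Finset ι, (∑ i ∈ s, v i • δ i) a = ∑ i ∈ s, v i * δ i a := by
    classical
    intro s
    induction s using Finset.induction_on with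
    | empty => simp
    | insert i s hi ih => simp [Finset.sum_insert hi, ih]
  exact h _

theorem ofVec_coord [DecidableEq ι] {z : ι → O} (hz : ∀ i j, δ i (z j) = if i = j then 1 else 0)
    (v : ι → O) (j : ι) : ofVec δ v (z j) = v j := by
  simp [ofVec_apply, hz]

theorem ofVec_commutator (hδ : ∀ i j a, δ i (δ j a) = δ j (δ i a)) (u v : ι → O) (a : O) :
    ofVec δ u (ofVec δ v a) = ofVec δ v (ofVec δ u a) +
      ofVec δ (fun i => ofVec δ u (v i) - ofVec δ v (u i)) a := by
  have h : ∀ u v : ι → O, ofVec δ u (ofVec δ v a) =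
      ∑ i, ∑ j, u i * v j * δ i (δ j a) + ∑ j, ofVec δ u (v j) * δ j a := by
    intro u v
    rw [ofVec_apply v a, map_sum, ← Finset.sum_comm, ← Finset.sum_add_distrib]
    refine Finset.sum_congr rfl fun j _ => ?_
    rw [leibniz, smul_eq_mul, smul_eq_mul, ofVec_apply u (δ j a), Finset.mul_sum, mul_comm (δ j a)]
    congr 1
    exact Finset.sum_congr rfl fun i _ => by ring
  rw [h u v, h v u, ofVec_apply, Finset.sum_comm]
  simp only [sub_mul, Finset.sum_sub_distrib]
  have : ∀ i j, u j * v i * δ j (δ i a) = v i * u j * δ i (δ j a) := fun i j => by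
    rw [hδ]; ring
  simp only [this]
  ring


/-- A vector field annihilating `f` preserves the ideal generated by the partial derivatives
of `f`. -/
theorem ofVec_mem_of_ofVec_eq_zero (hδ : ∀ i j a, δ i (δ j a) = δ j (δ i a)) {f : O} {u : ι → O}
    (hu : ofVec δ u f = 0) {a : O} (ha : a ∈ Ideal.span (Set.range fun i => δ i f)) :
    ofVec δ u a ∈ Ideal.span (Set.range fun i => δ i f) := by
  induction ha using Submodule.span_induction with
  | mem x hx =>
    obtain ⟨i, rfl⟩ := hx
    have h : δ i (ofVec δ u f) = ofVec δ u (δ i f) + ∑ j, δ j f * δ i (u j) := by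
      simp only [ofVec_apply, map_sum, leibniz, smul_eq_mul, Finset.sum_add_distrib]
      simp only [hδ i]
    rw [hu, map_zero] at h
    rw [eq_neg_of_add_eq_zero_left h.symm]
    exact neg_mem (Ideal.sum_mem _ fun j _ => Ideal.mul_mem_right _ _
      (Ideal.subset_span ⟨j, rfl⟩))
  | zero => simp
  | add x y _ _ hx hy => rw [map_add]; exact add_mem hx hy
  | smul c x hx h =>
    rw [smul_eq_mul, leibniz, smul_eq_mul, smul_eq_mul]
    exact add_mem (Ideal.mul_mem_left _ _ h) (Ideal.mul_mem_right _ _ hx)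

/-- Vector fields dual to functions with an invertible principal Jacobian minor. -/
theorem exists_dual_vec [DecidableEq ι] (T : Finset ι) {w : ι → O}
    (hdet : IsUnit (Matrix.of fun i j : T => δ (i : ι) (w j)).det) :
    ∃ m : T → ι → O, (∀ l, ∀ i ∉ T, m l i = 0) ∧
      ∀ l l' : T, ofVec δ (m l) (w l') = if l = l' then 1 else 0 := by
  set A : Matrix T T O := Matrix.of fun i j : T => δ (i : ι) (w j) with hA
  refine ⟨fun l i => if h : i ∈ T then A⁻¹ l ⟨i, h⟩ else 0, fun l i hi => by simp [hi],
    fun l l' => ?_⟩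
  have h := congrFun (congrFun (Matrix.nonsing_inv_mul A hdet) l) l'
  rw [Matrix.mul_apply, Matrix.one_apply] at h
  rw [← h, ofVec_apply, ← Finset.sum_subset (Finset.subset_univ T), ← Finset.sum_coe_sort T]
  · refine Finset.sum_congr rfl fun i _ => ?_
    simp [hA]
  · intro i _ hi
    simp [hi]

section Nakayama

variable [IsLocalRing O]

/-- If the residue field is `k`, a finite generating family of an ideal generated by `r` elements
contains at most `r` elements which generate the ideal. -/
theorem _root_.Ideal.exists_finset_card_le_span_eq (ev : O →ₐ[k] k)
    (a : ι → O) {r : ℕ} (g : Fin r → O)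
    (hg : Ideal.span (Set.range g) = Ideal.span (Set.range a)) :
    ∃ S : Finset ι, S.card ≤ r ∧ Ideal.span (a '' S) = Ideal.span (Set.range a) := by
  classical
  have hc : ∀ j, ∃ c : Fin r → O, ∑ i, c i * g i = a j := fun j => by
    have h : a j ∈ Ideal.span (Set.range g) := hg ▸ Ideal.subset_span ⟨j, rfl⟩
    exact Ideal.mem_span_range_iff_exists_fun.1 h
  choose c hc using hc
  obtain ⟨S, -, -, hspan, hli⟩ := exists_linearIndepOn_extension (K := k)
    (v := fun j i => ev (c j i)) (linearIndepOn_empty k _) (Set.empty_subset Set.univ)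
  have hfin : S.Finite := Set.toFinite S
  refine ⟨hfin.toFinset, ?_, le_antisymm (Ideal.span_mono (by simp)) ?_⟩
  · have h := LinearIndependent.fintype_card_le_finrank (R := k) (M := Fin r → k)
      (b := fun x : S => fun i => ev (c x i)) hli
    rw [Module.finrank_fin_fun, ← Nat.card_eq_fintype_card] at h
    rwa [← Set.ncard_eq_toFinset_card S hfin]
  · rw [Set.Finite.coe_toFinset]
    refine Submodule.le_of_le_smul_of_le_jacobson_bot (I := IsLocalRing.maximalIdeal O)
      (Submodule.fg_span (Set.finite_range a)) (IsLocalRing.maximalIdeal_le_jacobson _) ?_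
    refine Ideal.span_le.2 ?_
    rintro _ ⟨j, rfl⟩
    have hj : (fun i => ev (c j i)) ∈ Submodule.span k ((fun j i => ev (c j i)) '' S) :=
      hspan ⟨j, trivial, rfl⟩
    rw [Set.image_eq_range, Submodule.mem_span_range_iff_exists_fun] at hj
    obtain ⟨l, hl⟩ := hj
    have h1 : a j - ∑ x : S, algebraMap k O (l x) * a x =
        ∑ i, (c j i - ∑ x : S, algebraMap k O (l x) * c x i) * g i := by
      simp only [← hc, sub_mul, Finset.sum_sub_distrib, Finset.mul_sum, Finset.sum_mul]
      rw [Finset.sum_comm]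
      simp only [mul_assoc]
    have h2 : a j = ∑ x : S, algebraMap k O (l x) * a x +
        ∑ i, (c j i - ∑ x : S, algebraMap k O (l x) * c x i) * g i := by
      rw [← h1]; ring
    change a j ∈ _
    rw [h2]
    refine Submodule.add_mem_sup (Ideal.sum_mem _ fun x _ => Ideal.mul_mem_left _ _
      (Ideal.subset_span ⟨x, x.2, rfl⟩)) (Ideal.sum_mem _ fun i _ => ?_)
    refine Submodule.smul_mem_smul ?_ (hg ▸ Ideal.subset_span ⟨i, rfl⟩)
    rw [IsLocalRing.mem_maximalIdeal, mem_nonunits_iff]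
    intro hu
    have h3 : ev (c j i - ∑ x : S, algebraMap k O (l x) * c x i) = 0 := by
      have := congrFun hl i
      simp only [Finset.sum_apply, Pi.smul_apply, smul_eq_mul] at this
      simp [map_sum, this]
    exact (hu.map ev).ne_zero h3

end Nakayama

/-- Partial derivatives generating a reduced ideal of the expected dimension have
an invertible Hessian minor. -/
theorem exists_det_hessian_ne_zero [CharZero k] [DecidableEq ι] [IsLocalRing O] (ev : O →ₐ[k] k)
    (hev : ∀ a, ev a ≠ 0 → IsUnit a) (hδ : ∀ i j a, δ i (δ j a) = δ j (δ i a))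
    {z : ι → O} (hz : ∀ i j, δ i (z j) = if i = j then 1 else 0) (hz0 : ∀ j, ev (z j) = 0)
    {f : O} (hf0 : ∀ i, ev (δ i f) = 0) {r d : ℕ} (hrd : d + r = Fintype.card ι)
    (g : Fin r → O) (hg : Ideal.span (Set.range g) = Ideal.span (Set.range fun i => δ i f))
    (hrad : (Ideal.span (Set.range fun i => δ i f)).IsRadical)
    (hdim : ringKrullDim (O ⧸ Ideal.span (Set.range fun i => δ i f)) = d) :
    ∃ S : Finset ι, S.card = r ∧
      Ideal.span ((fun i => δ i f) '' S) = Ideal.span (Set.range fun i => δ i f) ∧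
      (Matrix.of fun i j : S => ev (δ (i : ι) (δ (j : ι) f))).det ≠ 0 := by
  set I := Ideal.span (Set.range fun i => δ i f) with hI
  have hmax : ∀ a, a ∈ IsLocalRing.maximalIdeal O ↔ ev a = 0 := fun a => by
    rw [IsLocalRing.mem_maximalIdeal, mem_nonunits_iff]
    refine ⟨fun h => by_contra fun h' => h (hev a h'), fun h hu => (hu.map ev).ne_zero h⟩
  have hfI : ∀ i, δ i f ∈ I := fun i => Ideal.subset_span ⟨i, rfl⟩
  have hIm : I ≤ IsLocalRing.maximalIdeal O := by
    refine Ideal.span_le.2 ?_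
    rintro _ ⟨i, rfl⟩
    exact (hmax _).2 (hf0 i)
  obtain ⟨S₀, hS₀, hspan₀⟩ := Ideal.exists_finset_card_le_span_eq ev (fun i => δ i f) g hg
  obtain ⟨S, hS₀S, -, hS⟩ := Finset.exists_subsuperset_card_eq (Finset.subset_univ S₀) hS₀
    (by rw [Finset.card_univ]; omega)
  have hspan : Ideal.span ((fun i => δ i f) '' S) = I :=
    le_antisymm (Ideal.span_mono (Set.image_subset_range _ _))
      (hspan₀.symm.le.trans (Ideal.span_mono (Set.image_mono (by exact_mod_cast hS₀S))))
  -- express all partial derivatives through those indexed by `S`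
  have he : ∀ j, ∃ e : S → O, ∑ i : S, e i * δ (i : ι) f = δ j f := fun j => by
    have h : δ j f ∈ Ideal.span ((fun i => δ i f) '' S) := hspan ▸ hfI j
    rw [Set.image_eq_range] at h
    exact Ideal.mem_span_range_iff_exists_fun.1 h
  choose e he using he
  -- vector fields annihilating `f`
  let X : ↥Sᶜ → ι → O := fun j i => if h : i ∈ S then -e j ⟨i, h⟩ else if i = j then 1 else 0
  have hXf : ∀ j, ofVec δ (X j) f = 0 := fun j => by
    rw [ofVec_apply, ← Finset.sum_add_sum_compl S, ← Finset.sum_coe_sort S]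
    have h1 : ∑ i : S, X j i * δ (i : ι) f = -δ (j : ι) f := by
      rw [← he j, ← Finset.sum_neg_distrib]
      exact Finset.sum_congr rfl fun i _ => by simp [X]
    have h2 : ∑ i ∈ Sᶜ, X j i * δ i f = δ (j : ι) f := by
      rw [Finset.sum_eq_single_of_mem (j : ι) j.2]
      · simp [X, Finset.mem_compl.1 j.2]
      · intro i hi hij
        simp [X, Finset.mem_compl.1 hi, hij]
    rw [h1, h2, neg_add_cancel]
  have hXz : ∀ j j' : ↥Sᶜ, ofVec δ (X j) (z j') = if j = j' then 1 else 0 := fun j j' => by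
    rw [ofVec_coord hz]
    have h : j = j' ↔ (j' : ι) = j := eq_comm.trans Subtype.ext_iff
    simp [h, X, Finset.mem_compl.1 j'.2]
  -- a maximal nondegenerate principal minor of the Hessian inside `S`
  let H : Matrix ι ι k := Matrix.of fun i j => ev (δ i (δ j f))
  have hH : H.IsSymm := Matrix.IsSymm.ext fun i j => by simp [H, hδ]
  obtain ⟨T', hT'S, -, hspanT, hli⟩ := exists_linearIndepOn_extension (K := k)
    (v := H.row) (linearIndepOn_empty k _) (Set.empty_subset (S : Set ι))
  obtain ⟨T, rfl⟩ : ∃ T : Finset ι, (T : Set ι) = T' := ⟨_, (Set.toFinite T').coe_toFinset⟩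
  have hc : ∀ j, ∃ c : T → k, ∀ i, H j i = ∑ l, c l * H l i := fun j => by
    have h1 : H.row j = ∑ i : S, ev (e j i) • H.row i := by
      ext l
      rw [Matrix.row, ← hH.apply, Finset.sum_apply]
      simp only [H, Matrix.of_apply, Pi.smul_apply, smul_eq_mul]
      rw [← he j]
      simp only [map_sum, leibniz, smul_eq_mul, map_add, map_mul, hf0, zero_mul, add_zero]
      refine Finset.sum_congr rfl fun i _ => ?_
      rw [hδ]
    have h2 : H.row j ∈ Submodule.span k (H.row '' T) := by
      rw [h1]
      exact Submodule.sum_mem _ fun i _ => Submodule.smul_mem _ _ (hspanT ⟨i, i.2, rfl⟩)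
    rw [Set.image_eq_range, Submodule.mem_span_range_iff_exists_fun] at h2
    obtain ⟨c, hc⟩ := h2
    refine ⟨c, fun i => ?_⟩
    have := congrFun hc i
    simp only [Finset.sum_apply, Pi.smul_apply, Matrix.row, smul_eq_mul] at this
    exact this.symm
  choose c hc using hc
  have hdet := H.det_submatrix_ne_zero_of_isSymm hH T hli c hc
  have hunit : IsUnit (Matrix.of fun i j : T => δ (i : ι) (δ (j : ι) f)).det := by
    refine hev _ ?_
    rw [AlgHom.map_det]
    exact hdet
  obtain ⟨m, hmT, hm⟩ := exists_dual_vec T (w := fun i => δ i f) hunit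
  -- projection of vector fields to those annihilating `δ l f`, `l ∈ T`
  let P : (ι → O) → ι → O := fun u i => u i - ∑ l : T, ofVec δ u (δ (l : ι) f) * m l i
  have hP : ∀ u a, ofVec δ (P u) a =
      ofVec δ u a - ∑ l : T, ofVec δ u (δ (l : ι) f) * ofVec δ (m l) a := fun u a => by
    rw [ofVec_apply (P u), ofVec_apply u a]
    simp only [P, ofVec_apply (m _) a, sub_mul, Finset.sum_sub_distrib, Finset.sum_mul,
      Finset.mul_sum, mul_assoc]
    rw [Finset.sum_comm]
  have hPT : ∀ u, ∀ l : T, ofVec δ (P u) (δ (l : ι) f) = 0 := fun u l => by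
    rw [hP, Finset.sum_eq_single l] <;> simp +contextual [hm]
  let K : Ideal O := I ⊔ Ideal.span
    {b | ∃ v : ι → O, (∀ l : T, ofVec δ v (δ (l : ι) f) = 0) ∧ ∃ a ∈ I, b = ofVec δ v a}
  have hKm : K ≤ IsLocalRing.maximalIdeal O := by
    refine sup_le hIm (Ideal.span_le.2 ?_)
    rintro _ ⟨v, hv, a, ha, rfl⟩
    refine (hmax _).2 ?_
    induction ha using Submodule.span_induction with
    | mem x hx =>
      obtain ⟨j, rfl⟩ := hx
      have h1 : ∀ j, ev (ofVec δ v (δ j f)) = ∑ i, ev (v i) * H j i := fun j => by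
        simp [ofVec_apply, H, map_sum, hδ j]
      simp only [h1, hc j]
      have h2 : ∀ l : T, ∑ i, ev (v i) * H l i = 0 := fun l => by rw [← h1, hv, map_zero]
      simp only [Finset.mul_sum]
      rw [Finset.sum_comm]
      refine Finset.sum_eq_zero fun l _ => ?_
      rw [← mul_zero (c j l), ← h2 l, Finset.mul_sum]
      exact Finset.sum_congr rfl fun i _ => by ring
    | zero => simp
    | add x y _ _ hx hy => rw [map_add, map_add, hx, hy, add_zero]
    | smul b x hx h =>
      have h0 : ev x = 0 := (hmax x).1 (hIm hx)
      simp [h, h0]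
  have hKstab : ∀ j, ∀ a ∈ K, ofVec δ (X j) a ∈ K := by
    intro j b hb
    have hIstab : ∀ a ∈ I, ofVec δ (X j) a ∈ I := fun a ha =>
      ofVec_mem_of_ofVec_eq_zero hδ (hXf j) ha
    have hsumI : ∀ a, ∑ l : T, ofVec δ (X j) (δ (l : ι) f) * ofVec δ (m l) a ∈ I := fun a =>
      Ideal.sum_mem _ fun l _ => Ideal.mul_mem_right _ _ (hIstab _ (hfI l))
    have hPI : ∀ a ∈ I, ofVec δ (P (X j)) a ∈ I := fun a ha => by
      rw [hP]; exact sub_mem (hIstab a ha) (hsumI a)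
    obtain ⟨a₁, ha₁, a, ha, rfl⟩ := Submodule.mem_sup.1 hb
    rw [map_add]
    refine add_mem (Ideal.mem_sup_left (hIstab a₁ ha₁)) ?_
    clear hb
    have key : ofVec δ (P (X j)) a ∈ K := by
      induction ha using Submodule.span_induction with
      | mem x hx =>
        obtain ⟨v, hv, a, ha, rfl⟩ := hx
        rw [ofVec_commutator hδ]
        refine add_mem (Ideal.mem_sup_right (Ideal.subset_span ⟨v, hv, _, hPI a ha, rfl⟩))
          (Ideal.mem_sup_right (Ideal.subset_span ⟨_, fun l => ?_, a, ha, rfl⟩))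
        have h := ofVec_commutator hδ (P (X j)) v (δ (l : ι) f)
        rw [hv, hPT, map_zero, map_zero, zero_add] at h
        exact h.symm
      | zero => simp
      | add x y _ _ hx hy => rw [map_add]; exact add_mem hx hy
      | smul b x hx h =>
        rw [smul_eq_mul, leibniz, smul_eq_mul, smul_eq_mul]
        exact add_mem (Ideal.mul_mem_left _ _ h)
          (Ideal.mul_mem_right _ _ (Ideal.mem_sup_right hx))
    have := hP (X j) a
    rw [eq_sub_iff_add_eq] at this
    rw [← this]
    exact add_mem key (Ideal.mem_sup_left (hsumI a))
  have hcardS : Nat.card ↥Sᶜ = d := by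
    rw [Nat.card_eq_fintype_card, Fintype.card_coe, Finset.card_compl]; omega
  have hKI : K ≤ I := le_of_stable_of_ringKrullDim_le (D := fun j => ofVec δ (X j))
    (t := fun j : ↥Sᶜ => z j) (fun j => (hmax _).2 (hz0 j)) hXz hrad hIm
    (fun j a ha => ofVec_mem_of_ofVec_eq_zero hδ (hXf j) ha) (by rw [hdim, hcardS]) hKm hKstab
  -- the coordinate vector fields complementary to `T` preserve `I`
  let Y : ↥Tᶜ → ι → O := fun j => P (Pi.single (j : ι) 1)
  have hYz : ∀ j j' : ↥Tᶜ, ofVec δ (Y j) (z j') = if j = j' then 1 else 0 := fun j j' => by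
    rw [ofVec_coord hz]
    have h : j = j' ↔ (j' : ι) = j := eq_comm.trans Subtype.ext_iff
    simp [h, Y, P, hmT _ _ (Finset.mem_compl.1 j'.2), Pi.single_apply]
  have hle := natCard_le_ringKrullDim_quotient (I := I) (D := fun j => ofVec δ (Y j))
    (t := fun j : ↥Tᶜ => z j) (p := IsLocalRing.maximalIdeal O) inferInstance
    (fun j => (hmax _).2 (hz0 j)) hYz hIm (fun j a ha => hKI (Ideal.mem_sup_right
      (Ideal.subset_span ⟨_, hPT _, a, ha, rfl⟩)))
  rw [hdim, Nat.card_eq_fintype_card, Fintype.card_coe, Finset.card_compl] at hle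
  have hle' : Fintype.card ι - T.card ≤ d := by exact_mod_cast hle
  obtain rfl : T = S := Finset.eq_of_subset_of_card_le (by exact_mod_cast hT'S) (by omega)
  exact ⟨T, hS, hspan, hdet⟩

end Derivation

end JacobianIdeal

section Germs

variable {n : ℕ}

theorem AnalyticAt.pder {f : Cn n → ℂ} {x : Cn n} (hf : AnalyticAt ℂ f x) (i : Fin n) :
    AnalyticAt ℂ (pder f i) x :=
  ((ContinuousLinearMap.apply ℂ ℂ (Pi.single i 1 : Cn n)).analyticAt _).comp hf.fderiv

theorem pder_pder_comm {f : Cn n → ℂ} {x : Cn n} (hf : AnalyticAt ℂ f x) (i j : Fin n) :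
    pder (pder f j) i x = pder (pder f i) j x := by
  have h : ∀ i j, pder (pder f j) i x =
      fderiv ℂ (fderiv ℂ f) x (Pi.single i 1) (Pi.single j 1) := fun i j => by
    have h1 : HasFDerivAt (pder f j) _ x :=
      (ContinuousLinearMap.apply ℂ ℂ (Pi.single j 1 : Cn n)).hasFDerivAt.comp x
        hf.fderiv.differentiableAt.hasFDerivAt
    rw [pder, h1.fderiv]
    rfl
  rw [h, h]
  exact (hf.contDiffAt (n := ⊤)).isSymmSndFDerivAt (by simp) _ _

/-- The germ at `0` of a function which is analytic at `0`. -/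
def germOf (f : Cn n → ℂ) (hf : AnalyticAt ℂ f 0) : On n := ⟨↑f, f, hf, rfl⟩

theorem exists_germOf (a : On n) : ∃ f hf, a = germOf f hf := by
  obtain ⟨_, f, hf, rfl⟩ := a
  exact ⟨f, hf, rfl⟩

theorem germOf_eq_iff {f g : Cn n → ℂ} {hf : AnalyticAt ℂ f 0} {hg : AnalyticAt ℂ g 0} :
    germOf f hf = germOf g hg ↔ f =ᶠ[𝓝 0] g :=
  Subtype.ext_iff.trans Filter.Germ.coe_eq

/-- Evaluation at `0` of germs. -/
def evalGerm (n : ℕ) : On n →ₐ[ℂ] ℂ where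
  toRingHom := Filter.Germ.valueRingHom.comp (On n).val.toRingHom
  commutes' _ := rfl

theorem evalGerm_germOf {f : Cn n → ℂ} (hf : AnalyticAt ℂ f 0) :
    evalGerm n (germOf f hf) = f 0 := rfl

theorem isUnit_of_evalGerm_ne_zero (a : On n) (ha : evalGerm n a ≠ 0) : IsUnit a := by
  obtain ⟨f, hf, rfl⟩ := exists_germOf a
  refine IsUnit.of_mul_eq_one (germOf f⁻¹ (hf.inv ha)) (germOf_eq_iff (hf := hf.mul (hf.inv ha))
    (hg := analyticAt_const (v := (1 : ℂ))).2 ?_)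
  filter_upwards [hf.continuousAt.eventually_ne ha] with z hz
  exact mul_inv_cancel₀ hz

instance : IsLocalRing (On n) :=
  have : Nontrivial (On n) := (evalGerm n).toRingHom.domain_nontrivial
  .of_isUnit_or_isUnit_one_sub_self fun a => by
    by_cases ha : evalGerm n a = 0
    · exact .inr (isUnit_of_evalGerm_ne_zero _ (by simp [ha]))
    · exact .inl (isUnit_of_evalGerm_ne_zero _ ha)

/-- The `i`-th partial derivative of a germ. -/
def pderFun (i : Fin n) (a : On n) : On n :=
  germOf (pder a.2.choose i) (a.2.choose_spec.1.pder i)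

theorem pderFun_germOf {f : Cn n → ℂ} (hf : AnalyticAt ℂ f 0) (i : Fin n) :
    pderFun i (germOf f hf) = germOf (pder f i) (hf.pder i) := by
  have h : f =ᶠ[𝓝 0] (germOf f hf).2.choose :=
    Filter.Germ.coe_eq.1 (germOf f hf).2.choose_spec.2
  refine germOf_eq_iff.2 ?_
  filter_upwards [h.fderiv (𝕜 := ℂ)] with z hz
  rw [pder, pder, hz]

/-- The partial derivatives as derivations of the ring of germs. -/
def pderGerm (i : Fin n) : Derivation ℂ (On n) (On n) :=
  Derivation.mk'
    { toFun := pderFun i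
      map_add' := fun a b => by
        obtain ⟨f, hf, rfl⟩ := exists_germOf a
        obtain ⟨g, hg, rfl⟩ := exists_germOf b
        refine (pderFun_germOf (hf.add hg) i).trans ?_
        rw [pderFun_germOf, pderFun_germOf]
        refine (germOf_eq_iff (hg := (hf.pder i).add (hg.pder i))).2 ?_
        filter_upwards [hf.eventually_analyticAt, hg.eventually_analyticAt] with z hfz hgz
        simp [pder, fderiv_add hfz.differentiableAt hgz.differentiableAt]
      map_smul' := fun c a => by
        obtain ⟨f, hf, rfl⟩ := exists_germOf a
        refine (pderFun_germOf (hf.const_smul (c := c)) i).trans ?_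
        rw [pderFun_germOf]
        refine (germOf_eq_iff (hg := (hf.pder i).const_smul (c := c))).2 ?_
        filter_upwards [hf.eventually_analyticAt] with z hfz
        simp [pder, fderiv_const_smul hfz.differentiableAt] }
    fun a b => by
      obtain ⟨f, hf, rfl⟩ := exists_germOf a
      obtain ⟨g, hg, rfl⟩ := exists_germOf b
      refine (pderFun_germOf (hf.mul hg) i).trans ?_
      change _ = _ * pderFun i _ + _ * pderFun i _
      rw [pderFun_germOf, pderFun_germOf]
      refine (germOf_eq_iff (hg := (hf.mul (hg.pder i)).add (hg.mul (hf.pder i)))).2 ?_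
      filter_upwards [hf.eventually_analyticAt, hg.eventually_analyticAt] with z hfz hgz
      simp [pder, fderiv_mul hfz.differentiableAt hgz.differentiableAt]

theorem pderGerm_germOf {f : Cn n → ℂ} (hf : AnalyticAt ℂ f 0) (i : Fin n) :
    pderGerm i (germOf f hf) = germOf (pder f i) (hf.pder i) := pderFun_germOf hf i

theorem pderGerm_comm (i j : Fin n) (a : On n) :
    pderGerm i (pderGerm j a) = pderGerm j (pderGerm i a) := by
  obtain ⟨f, hf, rfl⟩ := exists_germOf a
  simp only [pderGerm_germOf]
  refine germOf_eq_iff.2 ?_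
  filter_upwards [hf.eventually_analyticAt] with z hz
  exact pder_pder_comm hz i j

/-- The germs of the coordinates. -/
def coordGerm (j : Fin n) : On n :=
  germOf (fun z => z j) ((ContinuousLinearMap.proj (R := ℂ) (φ := fun _ : Fin n => ℂ) j).analyticAt 0)

theorem pderGerm_coordGerm (i j : Fin n) :
    pderGerm i (coordGerm j) = if i = j then 1 else 0 := by
  refine (pderGerm_germOf _ i).trans ?_
  have h : pder (fun z : Cn n => z j) i = fun _ => if i = j then 1 else 0 := by
    ext z
    have := (ContinuousLinearMap.proj (R := ℂ) (φ := fun _ : Fin n => ℂ) j).hasFDerivAt (x := z)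
    refine (congrArg (fun L : Cn n →L[ℂ] ℂ => L (Pi.single i 1)) this.fderiv).trans ?_
    simp [Pi.single_apply, eq_comm]
  refine ((germOf_eq_iff (hg := analyticAt_const)).2 (Filter.EventuallyEq.of_eq h)).trans ?_
  split_ifs <;> rfl

theorem idealOfFuns_range {ι : Type*} (g : ι → Cn n → ℂ) (hg : ∀ i, AnalyticAt ℂ (g i) 0) :
    idealOfFuns (Set.range g) = Ideal.span (Set.range fun i => germOf (g i) (hg i)) := by
  refine congrArg Ideal.span (Set.ext fun x => ⟨?_, ?_⟩)
  · rintro ⟨_, ⟨i, rfl⟩, hx⟩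
    exact ⟨i, Subtype.ext hx.symm⟩
  · rintro ⟨i, rfl⟩
    exact ⟨_, ⟨i, rfl⟩, rfl⟩

/-- If the jacobian ideal is generated by functions vanishing at `0`, then `0` is critical. -/
theorem pder_eq_zero_of_jacobianIdeal_eq {ι : Type*} {f : Cn n → ℂ} (hf : AnalyticAt ℂ f 0)
    {g : ι → Cn n → ℂ} (hg : ∀ i, AnalyticAt ℂ (g i) 0) (hg0 : ∀ i, g i 0 = 0)
    (hJ : jacobianIdeal f = idealOfFuns (Set.range g)) (k : Fin n) : pder f k 0 = 0 := by
  have h1 : germOf (pder f k) (hf.pder k) ∈ idealOfFuns (Set.range g) :=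
    hJ ▸ Ideal.subset_span ⟨pder f k, ⟨k, rfl⟩, rfl⟩
  have h2 : idealOfFuns (Set.range g) ≤ RingHom.ker (evalGerm n) := by
    rw [idealOfFuns_range g hg, Ideal.span_le]
    rintro _ ⟨i, rfl⟩
    exact (evalGerm_germOf (hg i)).trans (hg0 i)
  exact (evalGerm_germOf (hf.pder k)).symm.trans (h2 h1)

/-- If the jacobian ideal is reduced of the expected dimension, then it is generated by `r` partial
derivatives, and the corresponding minor of the Hessian matrix at `0` does not vanish. -/
theorem exists_det_hessian_ne_zero {d r : ℕ} (hdr : d + r = n) {f : Cn n → ℂ}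
    (hf : AnalyticAt ℂ f 0) {g : Fin r → Cn n → ℂ} (hg : ∀ i, AnalyticAt ℂ (g i) 0)
    (hg0 : ∀ i, g i 0 = 0) (hJ : jacobianIdeal f = idealOfFuns (Set.range g))
    (hred : IsReduced (On n ⧸ jacobianIdeal f))
    (hdim : ringKrullDim (On n ⧸ jacobianIdeal f) = d) :
    ∃ S : Finset (Fin n), S.card = r ∧
      (∀ k, ∃ c : S → Cn n → ℂ, ∀ᶠ z in 𝓝 0, pder f k z = ∑ l, c l z * pder f l z) ∧
      (Matrix.of fun i j : S => pder (pder f j) i 0).det ≠ 0 := by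
  have hJf : jacobianIdeal f = Ideal.span (Set.range fun i => pderGerm i (germOf f hf)) := by
    simp only [pderGerm_germOf]
    exact idealOfFuns_range _ fun i => hf.pder i
  have hcrit := pder_eq_zero_of_jacobianIdeal_eq hf hg hg0 hJ
  rw [idealOfFuns_range g hg] at hJ
  obtain ⟨S, hS, hspan, hdet⟩ := Derivation.exists_det_hessian_ne_zero (evalGerm n)
    isUnit_of_evalGerm_ne_zero pderGerm_comm pderGerm_coordGerm (fun _ => rfl)
    (fun i => (congrArg (evalGerm n) (pderGerm_germOf hf i)).trans (hcrit i))
    (hdr.trans (Fintype.card_fin n).symm) _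
    (hJ.symm.trans hJf) (hJf ▸ (Ideal.isRadical_iff_quotient_reduced _).2 hred) (hJf ▸ hdim)
  refine ⟨S, hS, fun k => ?_, ?_⟩
  · have h : pderGerm k (germOf f hf) ∈ Ideal.span ((fun i => pderGerm i (germOf f hf)) '' S) :=
      hspan ▸ Ideal.subset_span ⟨k, rfl⟩
    rw [Set.image_eq_range] at h
    obtain ⟨c, hc⟩ := Ideal.mem_span_range_iff_exists_fun.1 h
    choose c' hc' hcc' using fun l => exists_germOf (c l)
    refine ⟨c', ?_⟩
    have h2 : ((∑ l : S, c l * pderGerm (l : Fin n) (germOf f hf) : On n) :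
        Filter.Germ (𝓝 (0 : Cn n)) ℂ) = ((∑ l : S, c' l * pder f l : Cn n → ℂ) : Germ _ _) := by
      simp only [hcc', pderGerm_germOf]
      rw [← Subalgebra.coe_val, map_sum, ← Filter.Germ.coe_coeRingHom, map_sum]
      rfl
    have h3 : ((pder f k : Cn n → ℂ) : Germ (𝓝 (0 : Cn n)) ℂ) =
        ((∑ l : S, c' l * pder f l : Cn n → ℂ) : Germ _ _) := by
      rw [← h2]
      refine Eq.trans ?_ (congrArg Subtype.val hc.symm)
      rw [pderGerm_germOf]
      rfl
    filter_upwards [Filter.Germ.coe_eq.1 h3] with z hz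
    simpa using hz
  · simpa only [pderGerm_germOf, evalGerm_germOf] using hdet

end Germs

section Hadamard

variable {E X Y W : Type*} [NormedAddCommGroup E] [NormedSpace ℂ E] [NormedAddCommGroup X]
  [NormedSpace ℂ X] [NormedAddCommGroup Y] [NormedSpace ℂ Y] [NormedAddCommGroup W]
  [NormedSpace ℂ W] [CompleteSpace W]

/-- The average of an analytic map along a path of linear contractions is analytic. -/
theorem AnalyticAt.intervalIntegral_comp {g : E → W} (hg : AnalyticAt ℂ g 0) {L : ℝ → E →L[ℂ] E}
    (hL : Continuous L) (hL1 : ∀ s ∈ Set.Icc (0 : ℝ) 1, ‖L s‖ ≤ 1) :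
    AnalyticAt ℂ (fun z => ∫ s in (0 : ℝ)..1, g (L s z)) 0 := by
  obtain ⟨p, R, hp⟩ := hg
  have hL1' : ∀ s ∈ Set.uIoc (0 : ℝ) 1, ‖L s‖ ≤ 1 := fun s hs => by
    rw [Set.uIoc_of_le zero_le_one] at hs
    exact hL1 s ⟨hs.1.le, hs.2⟩
  let a : ∀ n, ℝ → E [×n]→L[ℂ] W := fun n s => (p n).compContinuousLinearMap fun _ => L s
  have ha : ∀ n, Continuous (a n) := fun n => by
    have h := (ContinuousMultilinearMap.compContinuousLinearMapContinuousMultilinear ℂ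
      (fun _ : Fin n => E) (fun _ => E) W).cont.comp (continuous_pi fun _ => hL)
    exact h.clm_apply continuous_const
  let q : FormalMultilinearSeries ℂ E W := fun n => ∫ s in (0 : ℝ)..1, a n s
  have hq : ∀ n, ‖q n‖ ≤ ‖p n‖ := fun n => by
    refine (intervalIntegral.norm_integral_le_of_norm_le_const (C := ‖p n‖) fun s hs => ?_).trans
      (by simp)
    refine ((p n).norm_compContinuousLinearMap_le _).trans ?_
    refine mul_le_of_le_one_right (norm_nonneg _) ?_
    exact Finset.prod_le_one (fun _ _ => norm_nonneg _) fun _ _ => hL1' s hs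
  have hqR : p.radius ≤ q.radius := FormalMultilinearSeries.radius_le_of_le hq
  have hq0 : 0 < q.radius := (hp.r_pos.trans_le hp.r_le).trans_le hqR
  refine (q.hasFPowerSeriesOnBall hq0).analyticAt.congr ?_
  filter_upwards [Metric.eball_mem_nhds (0 : E) hp.r_pos] with z hz
  refine HasSum.tsum_eq ?_
  have hqz : ∀ n, q n (fun _ => z) = ∫ s in (0 : ℝ)..1, p n fun _ => L s z := fun n =>
    ((ContinuousMultilinearMap.apply ℂ (fun _ : Fin n => E) W
      fun _ => z).intervalIntegral_comp_comm ((ha n).intervalIntegrable _ _)).symm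
  simp only [hqz]
  have hzR : (‖z‖₊ : ENNReal) < p.radius := by
    refine lt_of_lt_of_le ?_ hp.r_le
    simpa [edist_zero_right, enorm_eq_nnnorm] using hz
  have hsum := p.summable_norm_mul_pow hzR
  have hLz : ∀ s ∈ Set.uIoc (0 : ℝ) 1, ‖L s z‖ ≤ ‖z‖ := fun s hs =>
    ((L s).le_of_opNorm_le (hL1' s hs) z).trans (one_mul _).le
  refine intervalIntegral.hasSum_integral_of_dominated_convergence
    (fun n _ => ‖p n‖ * ‖z‖ ^ n) (fun n => ?_) (fun n => ?_) ?_ ?_ ?_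
  · refine Continuous.aestronglyMeasurable ?_
    exact (p n).cont.comp (continuous_pi fun _ => hL.clm_apply continuous_const)
  · refine Filter.Eventually.of_forall fun s hs => ?_
    refine ((p n).le_opNorm _).trans ?_
    rw [Finset.prod_const, Finset.card_univ, Fintype.card_fin]
    gcongr
    exact hLz s hs
  · exact Filter.Eventually.of_forall fun _ _ => hsum
  · exact intervalIntegrable_const
  · refine Filter.Eventually.of_forall fun s hs => ?_
    have h := hp.hasSum (y := L s z) ?_
    · rwa [zero_add] at h
    · rw [Metric.mem_eball, edist_zero_right] at hz ⊢
      refine lt_of_le_of_lt ?_ hz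
      rw [enorm_le_iff_norm_le]
      exact hLz s hs

/-- The endomorphism `(y, x) ↦ (y, s • x)`. -/
def scaleSnd (Y X : Type*) [NormedAddCommGroup X] [NormedSpace ℂ X] [NormedAddCommGroup Y]
    [NormedSpace ℂ Y] (s : ℝ) : Y × X →L[ℂ] Y × X :=
  (ContinuousLinearMap.inl ℂ Y X).comp (ContinuousLinearMap.fst ℂ Y X) +
    (s : ℂ) • (ContinuousLinearMap.inr ℂ Y X).comp (ContinuousLinearMap.snd ℂ Y X)

theorem scaleSnd_apply (s : ℝ) (z : Y × X) : scaleSnd Y X s z = (z.1, (s : ℂ) • z.2) := by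
  simp [scaleSnd]

theorem continuous_scaleSnd : Continuous (scaleSnd Y X) := by
  unfold scaleSnd; fun_prop

theorem norm_scaleSnd_le {s : ℝ} (hs : s ∈ Set.Icc (0 : ℝ) 1) : ‖scaleSnd Y X s‖ ≤ 1 := by
  refine ContinuousLinearMap.opNorm_le_bound _ zero_le_one fun z => ?_
  rw [scaleSnd_apply, one_mul, Prod.norm_def, Prod.norm_def, norm_smul]
  refine max_le_max le_rfl (mul_le_of_le_one_left (norm_nonneg _) ?_)
  simpa [abs_of_nonneg hs.1] using hs.2

/-- **Hadamard's lemma** with parameters. -/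
theorem AnalyticAt.exists_eq_add_apply_snd {F : Y × X → W} (hF : AnalyticAt ℂ F 0) :
    ∃ c : Y × X → X →L[ℂ] W, AnalyticAt ℂ c 0 ∧
      (∀ᶠ z in 𝓝 0, F z = F (z.1, 0) + c z z.2) ∧
      ∀ᶠ y in 𝓝 (0 : Y), c (y, 0) = (fderiv ℂ F (y, 0)).comp (ContinuousLinearMap.inr ℂ Y X) := by
  let G : Y × X → X →L[ℂ] W := fun z => (fderiv ℂ F z).comp (ContinuousLinearMap.inr ℂ Y X)
  have hG : AnalyticAt ℂ G 0 :=
    (((ContinuousLinearMap.compL ℂ X (Y × X) W).flip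
      (ContinuousLinearMap.inr ℂ Y X)).analyticAt _).comp hF.fderiv
  refine ⟨_, hG.intervalIntegral_comp continuous_scaleSnd fun s hs => norm_scaleSnd_le hs, ?_, ?_⟩
  · obtain ⟨ε, hε, h⟩ := Metric.eventually_nhds_iff_ball.1 hF.eventually_analyticAt
    filter_upwards [Metric.ball_mem_nhds 0 hε] with z hz
    have hmem : ∀ s ∈ Set.Icc (0 : ℝ) 1, scaleSnd Y X s z ∈ Metric.ball (0 : Y × X) ε := by
      intro s hs
      rw [mem_ball_zero_iff] at hz ⊢
      exact (((scaleSnd Y X s).le_of_opNorm_le (norm_scaleSnd_le hs) z).trans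
        (one_mul _).le).trans_lt hz
    have hcont : Continuous fun s : ℝ => scaleSnd Y X s z :=
      continuous_scaleSnd.clm_apply continuous_const
    have hGc : ContinuousOn (fun s : ℝ => G (scaleSnd Y X s z)) (Set.Icc 0 1) := fun s hs => by
      have h1 : ContinuousAt G (scaleSnd Y X s z) :=
        ((h _ (hmem s hs)).fderiv.continuousAt).clm_comp continuousAt_const
      exact (ContinuousAt.comp (f := fun s : ℝ => scaleSnd Y X s z) h1
        hcont.continuousAt).continuousWithinAt
    have hGi : IntervalIntegrable (fun s : ℝ => G (scaleSnd Y X s z)) MeasureTheory.volume 0 1 :=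
      ContinuousOn.intervalIntegrable (by rwa [Set.uIcc_of_le zero_le_one])
    have h2 := ((ContinuousLinearMap.apply ℂ W z.2 :
      (X →L[ℂ] W) →L[ℂ] W)).intervalIntegral_comp_comm hGi
    have h3 : ∀ s ∈ Set.uIcc (0 : ℝ) 1, HasDerivAt (fun s : ℝ => F (scaleSnd Y X s z))
        (G (scaleSnd Y X s z) z.2) s := fun s hs => by
      rw [Set.uIcc_of_le zero_le_one] at hs
      have h4 : HasDerivAt (fun s : ℝ => scaleSnd Y X s z) (0, z.2) s := by
        simp only [scaleSnd_apply]
        refine (hasDerivAt_const s z.1).prodMk ?_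
        simpa using (Complex.ofRealCLM.hasDerivAt (x := s)).smul_const z.2
      exact ((h _ (hmem s hs)).differentiableAt.hasFDerivAt.restrictScalars ℝ).comp_hasDerivAt s h4
    have h5 := intervalIntegral.integral_eq_sub_of_hasDerivAt h3
      (ContinuousOn.intervalIntegrable (by
        rw [Set.uIcc_of_le zero_le_one]; exact hGc.clm_apply continuousOn_const))
    simp only [scaleSnd_apply, Complex.ofReal_one, one_smul, Complex.ofReal_zero, zero_smul] at h5
    simp only [ContinuousLinearMap.apply_apply, scaleSnd_apply] at h2
    simp only [scaleSnd_apply]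
    rw [← h2, h5, add_sub_cancel]
  · refine Filter.Eventually.of_forall fun y => ?_
    simp [scaleSnd_apply, G]

end Hadamard

section LocalInverse

variable {𝕜 E F : Type*} [NontriviallyNormedField 𝕜] [NormedAddCommGroup E] [NormedSpace 𝕜 E]
  [CompleteSpace E] [NormedAddCommGroup F] [NormedSpace 𝕜 F]

/-- The analytic inverse function theorem. -/
theorem AnalyticAt.exists_openPartialHomeomorph {f : E → F} {a : E} (hf : AnalyticAt 𝕜 f a)
    {L : E ≃L[𝕜] F} (hL : HasFDerivAt f (L : E →L[𝕜] F) a) :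
    ∃ h : OpenPartialHomeomorph E F, (h : E → F) = f ∧ a ∈ h.source ∧
      AnalyticAt 𝕜 h.symm (f a) := by
  have hs : HasStrictFDerivAt f (L : E →L[𝕜] F) a := hL.fderiv ▸ hf.hasStrictFDerivAt
  exact ⟨hs.toOpenPartialHomeomorph f, rfl, hs.mem_toOpenPartialHomeomorph_source,
    (hs.toOpenPartialHomeomorph f).analyticAt_symm' hs.mem_toOpenPartialHomeomorph_source hf
      hL.fderiv⟩

end LocalInverse

section MatrixRoot

attribute [local instance] Matrix.linftyOpNormedRing Matrix.linftyOpNormedAlgebra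

variable {m : Type*} [Fintype m] [DecidableEq m]

/-- Matrices near `1` have an analytic square root compatible with transposition. -/
theorem Matrix.exists_analyticAt_sqrt :
    ∃ σ : Matrix m m ℂ → Matrix m m ℂ, AnalyticAt ℂ σ 1 ∧ σ 1 = 1 ∧
      (∀ᶠ A in 𝓝 1, σ A * σ A = A) ∧ ∀ᶠ A in 𝓝 1, A.transpose = A → (σ A).transpose = σ A := by
  have : CompleteSpace (Matrix m m ℂ) := FiniteDimensional.complete ℂ _
  let L : Matrix m m ℂ ≃L[ℂ] Matrix m m ℂ :=
    ContinuousLinearEquiv.smulLeft (Units.mk0 (2 : ℂ) two_ne_zero)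
  have hq : AnalyticAt ℂ (fun A : Matrix m m ℂ => A * A) 1 := analyticAt_id.mul analyticAt_id
  have hL : HasFDerivAt (fun A : Matrix m m ℂ => A * A)
      (L : Matrix m m ℂ →L[ℂ] Matrix m m ℂ) 1 := by
    refine ((hasFDerivAt_id (𝕜 := ℂ) (1 : Matrix m m ℂ)).mul'
      (hasFDerivAt_id (1 : Matrix m m ℂ))).congr_fderiv ?_
    ext1 A
    change (1 : Matrix m m ℂ) • A + A * 1 = (2 : ℂ) • A
    rw [one_smul, mul_one, two_smul]
  obtain ⟨h, hh, h1, hs⟩ := hq.exists_openPartialHomeomorph hL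
  have hh' : ∀ A, h A = A * A := fun A => congrFun hh A
  rw [mul_one] at hs
  have h1t : (1 : Matrix m m ℂ) ∈ h.target := by simpa [hh'] using h.map_source h1
  have hs1 : h.symm 1 = 1 := by simpa [hh'] using h.left_inv h1
  have hmem : ∀ᶠ A in 𝓝 (1 : Matrix m m ℂ), A ∈ h.target := h.open_target.mem_nhds h1t
  refine ⟨h.symm, hs, hs1, ?_, ?_⟩
  · filter_upwards [hmem] with A hA
    simpa [hh'] using h.right_inv hA
  · have hct : Tendsto (fun A => (h.symm A).transpose) (𝓝 (1 : Matrix m m ℂ)) (𝓝 1) := by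
      have h2 : Continuous (fun A : Matrix m m ℂ => A.transpose) :=
        (Matrix.transposeLinearEquiv m m ℂ ℂ).toLinearMap.continuous_of_finiteDimensional
      have h3 := (ContinuousAt.comp (h2.continuousAt (x := h.symm 1)) hs.continuousAt).tendsto
      rwa [Function.comp_apply, hs1, Matrix.transpose_one] at h3
    filter_upwards [hmem, hct (h.open_source.mem_nhds h1)] with A hA hA' hsymm
    refine h.injOn hA' (h.map_target hA) ?_
    have h3 : h.symm A * h.symm A = A := by simpa [hh'] using h.right_inv hA
    rw [hh', hh', h3, ← Matrix.transpose_mul, h3, hsymm]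

theorem Matrix.associated_toQuadraticMap {M : Matrix m m ℂ} (hM : M.transpose = M) :
    QuadraticMap.associated (R := ℂ) (LinearMap.BilinMap.toQuadraticMap (Matrix.toLinearMap₂' ℂ M))
      = Matrix.toLinearMap₂' ℂ M := by
  refine QuadraticMap.associated_left_inverse ℂ fun x y => ?_
  rw [Matrix.toLinearMap₂'_apply', Matrix.toLinearMap₂'_apply',
    dotProduct_comm y, Matrix.dotProduct_mulVec, ← Matrix.mulVec_transpose, hM]

/-- A nondegenerate complex symmetric matrix is congruent to the identity. -/
theorem Matrix.exists_eq_transpose_mul_self {M : Matrix m m ℂ} (hM : M.transpose = M)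
    (hdet : M.det ≠ 0) : ∃ P : Matrix m m ℂ, M = P.transpose * P := by
  have hsep : ∀ {M : Matrix m m ℂ}, M.transpose = M → M.det ≠ 0 →
      (QuadraticMap.associated (R := ℂ)
        (LinearMap.BilinMap.toQuadraticMap (Matrix.toLinearMap₂' ℂ M))).SeparatingLeft := by
    intro M hM hdet
    rw [Matrix.associated_toQuadraticMap hM]
    exact LinearMap.separatingLeft_toLinearMap₂'_iff_det_ne_zero.2 hdet
  obtain ⟨e⟩ := QuadraticForm.equivalent_of_isAlgClosed _ _ (hsep hM hdet)
    (hsep (M := 1) (by simp) (by simp))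
  refine ⟨LinearMap.toMatrix' (e.toLinearEquiv : (m → ℂ) →ₗ[ℂ] m → ℂ), ?_⟩
  set P := LinearMap.toMatrix' (e.toLinearEquiv : (m → ℂ) →ₗ[ℂ] m → ℂ) with hP
  apply (Matrix.toLinearMap₂' (n := m) (m := m) (S₁ := ℂ) (S₂ := ℂ) (N₂ := ℂ) ℂ).injective
  rw [← Matrix.associated_toQuadraticMap hM, ← Matrix.associated_toQuadraticMap
    (M := P.transpose * P) (by simp)]
  congr 1
  ext x
  have h := e.map_app x
  have hPx : e x = P.mulVec x := by simp [hP, LinearMap.toMatrix'_mulVec]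
  rw [hPx] at h
  simp only [LinearMap.BilinMap.toQuadraticMap_apply, Matrix.toLinearMap₂'_apply',
    Matrix.one_mulVec] at h ⊢
  rw [← h, ← Matrix.mulVec_mulVec, Matrix.dotProduct_mulVec x, Matrix.vecMul_transpose]

/-- An analytic family of nondegenerate symmetric matrices has an analytic family of square
roots for the congruence relation. -/
theorem Matrix.exists_analyticAt_eq_transpose_mul_self {E : Type*} [NormedAddCommGroup E]
    [NormedSpace ℂ E] {M : E → Matrix m m ℂ} {a : E} (hM : AnalyticAt ℂ M a)
    (hsymm : ∀ᶠ z in 𝓝 a, (M z).transpose = M z) (hdet : (M a).det ≠ 0) :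
    ∃ B : E → Matrix m m ℂ, AnalyticAt ℂ B a ∧ (B a).det ≠ 0 ∧
      ∀ᶠ z in 𝓝 a, M z = (B z).transpose * B z := by
  obtain ⟨P, hP⟩ := Matrix.exists_eq_transpose_mul_self hsymm.self_of_nhds hdet
  have hPdet : P.det ≠ 0 := fun h => hdet (by rw [hP, Matrix.det_mul, h, mul_zero])
  have hPu : IsUnit P.det := hPdet.isUnit
  have hPu' : IsUnit P.transpose.det := by rwa [Matrix.det_transpose]
  obtain ⟨σ, hσ, hσ1, hσσ, hσt⟩ := Matrix.exists_analyticAt_sqrt (m := m)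
  let N : E → Matrix m m ℂ := fun z => P⁻¹.transpose * M z * P⁻¹
  have hN : AnalyticAt ℂ N a := (analyticAt_const.mul hM).mul analyticAt_const
  have hNa : N a = 1 := by
    simp only [N]
    rw [hP, Matrix.transpose_nonsing_inv, ← mul_assoc, Matrix.nonsing_inv_mul _ hPu', one_mul,
      Matrix.mul_nonsing_inv _ hPu]
  have hNt : Tendsto N (𝓝 a) (𝓝 1) := hNa ▸ hN.continuousAt.tendsto
  refine ⟨fun z => σ (N z) * P, ?_, ?_, ?_⟩
  · exact (AnalyticAt.comp (by rwa [hNa]) hN).mul analyticAt_const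
  · simpa [hNa, hσ1] using hPdet
  · filter_upwards [hsymm, hNt hσσ, hNt hσt] with z h1 h2 h3
    have h4 : (σ (N z)).transpose = σ (N z) := h3 (by
      simp only [N]
      rw [Matrix.transpose_mul, Matrix.transpose_mul, h1, Matrix.transpose_transpose, mul_assoc])
    change σ (N z) * σ (N z) = N z at h2
    rw [Matrix.transpose_mul, h4, mul_assoc, ← mul_assoc (σ _), h2]
    simp only [N]
    rw [Matrix.transpose_nonsing_inv, mul_assoc, mul_assoc, Matrix.nonsing_inv_mul _ hPu, mul_one,
      ← mul_assoc, Matrix.mul_nonsing_inv _ hPu', one_mul]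

end MatrixRoot

theorem IsLinearMap.analyticAt {V W : Type*} [NormedAddCommGroup V] [NormedSpace ℂ V]
    [FiniteDimensional ℂ V] [NormedAddCommGroup W] [NormedSpace ℂ W] {f : V → W}
    (hf : IsLinearMap ℂ f) (x : V) : AnalyticAt ℂ f x :=
  (LinearMap.toContinuousLinearMap (hf.mk' f)).analyticAt x

section MorseBott

variable {Y : Type*} [NormedAddCommGroup Y] [NormedSpace ℂ Y] {m : Type*} [Fintype m]

/-- Derivative in the second variable. -/
def fderivSnd {X : Type*} [NormedAddCommGroup X] [NormedSpace ℂ X] (F : Y × X → ℂ) (z : Y × X) :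
    X →L[ℂ] ℂ :=
  (fderiv ℂ F z).comp (ContinuousLinearMap.inr ℂ Y X)

protected theorem AnalyticAt.fderivSnd {X : Type*} [NormedAddCommGroup X] [NormedSpace ℂ X]
    {F : Y × X → ℂ} {z : Y × X} (hF : AnalyticAt ℂ F z) : AnalyticAt ℂ (fderivSnd F) z :=
  (((ContinuousLinearMap.compL ℂ X (Y × X) ℂ).flip
    (ContinuousLinearMap.inr ℂ Y X)).analyticAt _).comp hF.fderiv

attribute [local instance] Matrix.linftyOpNormedRing Matrix.linftyOpNormedAlgebra

/-- The **Morse–Bott lemma** at a critical manifold which is a coordinate subspace. -/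
theorem AnalyticAt.exists_eq_sum_sq {F : Y × (m → ℂ) → ℂ} (hF : AnalyticAt ℂ F 0)
    (h0 : ∀ᶠ y in 𝓝 (0 : Y), F (y, 0) = 0) (h1 : ∀ᶠ y in 𝓝 (0 : Y), fderivSnd F (y, 0) = 0)
    (h2 : ∀ u : m → ℂ, fderiv ℂ (fderivSnd F) 0 (0, u) = 0 → u = 0) :
    ∃ T : Y × (m → ℂ) → (m → ℂ) →L[ℂ] (m → ℂ), AnalyticAt ℂ T 0 ∧
      (∃ L : (m → ℂ) ≃L[ℂ] (m → ℂ), T 0 = L) ∧ ∀ᶠ z in 𝓝 0, F z = ∑ i, T z z.2 i ^ 2 := by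
  classical
  have hfst : Tendsto (Prod.fst : Y × (m → ℂ) → Y) (𝓝 0) (𝓝 0) := continuous_fst.tendsto' _ _ rfl
  obtain ⟨c, hc, hFc, hc0⟩ := hF.exists_eq_add_apply_snd
  obtain ⟨b, hb, hcb, hb0⟩ := hc.exists_eq_add_apply_snd
  have hFc' : ∀ᶠ z in 𝓝 (0 : Y × (m → ℂ)), F z = c z z.2 := by
    filter_upwards [hFc, hfst.eventually h0] with z h3 h4
    rw [h3, h4, zero_add]
  have hFb : ∀ᶠ z in 𝓝 (0 : Y × (m → ℂ)), F z = b z z.2 z.2 := by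
    filter_upwards [hFc', hcb, hfst.eventually h1, hfst.eventually hc0] with z h3 h4 h5 h6
    have h7 : c (z.1, 0) = 0 := h6.trans h5
    rw [h3, h4, h7, zero_add]
  have hb0' : ∀ u, b 0 u = fderiv ℂ c 0 (0, u) := fun u => by
    have h3 : b 0 = _ := hb0.self_of_nhds
    rw [h3]; rfl
  have hess : ∀ u v, fderiv ℂ (fderivSnd F) 0 (0, u) v = b 0 u v + b 0 v u := by
    intro u v
    let D : Y × (m → ℂ) → (m → ℂ) →L[ℂ] ℂ := fun z => fderiv ℂ c z (0, v)
    have hD : AnalyticAt ℂ D 0 :=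
      AnalyticAt.comp (g := ContinuousLinearMap.apply ℂ ((m → ℂ) →L[ℂ] ℂ) ((0 : Y), v))
        (ContinuousLinearMap.analyticAt _ _) hc.fderiv
    have h3 : (fun z => fderivSnd F z v) =ᶠ[𝓝 0] fun z => D z z.2 + c z v := by
      filter_upwards [hFc'.eventually_nhds, hc.eventually_analyticAt] with z h4 h5
      have h6 := h5.differentiableAt.hasFDerivAt.clm_apply
        (hasFDerivAt_snd (𝕜 := ℂ) (p := z))
      have h7 : fderiv ℂ F z = _ := (h6.congr_of_eventuallyEq h4).fderiv
      simp [fderivSnd, h7, D, add_comm]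
    have h4 : HasFDerivAt (fun z => fderivSnd F z v) _ 0 :=
      hF.fderivSnd.differentiableAt.hasFDerivAt.clm_apply (hasFDerivAt_const v _)
    have h5 := ((hD.differentiableAt.hasFDerivAt.clm_apply
      (hasFDerivAt_snd (𝕜 := ℂ) (p := (0 : Y × (m → ℂ))))).add
      (hc.differentiableAt.hasFDerivAt.clm_apply (hasFDerivAt_const v _))).congr_of_eventuallyEq h3
    have h6 := congrArg (fun A => A (0, u)) (h4.unique h5)
    simp only [D] at h6
    simpa [hb0', add_comm] using h6
  let e : m → m → ℂ := fun i => Pi.single i 1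
  let Mlin : ((m → ℂ) →L[ℂ] (m → ℂ) →L[ℂ] ℂ) → Matrix m m ℂ := fun β =>
    Matrix.of fun i j => (2 : ℂ)⁻¹ * (β (e i) (e j) + β (e j) (e i))
  let M : Y × (m → ℂ) → Matrix m m ℂ := fun z => Mlin (b z)
  have hM : AnalyticAt ℂ M 0 := by
    refine AnalyticAt.comp (g := Mlin) (IsLinearMap.analyticAt ⟨fun β γ => ?_, fun t β => ?_⟩ _) hb
    · ext i j
      simp only [Mlin, Matrix.of_apply, Matrix.add_apply, _root_.add_apply]
      ring
    · ext i j
      simp only [Mlin, Matrix.of_apply, Matrix.smul_apply, _root_.smul_apply, smul_eq_mul]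
      ring
  have hMs : ∀ z, (M z).transpose = M z := fun z => by
    ext i j; simp [M, Mlin, add_comm]
  have hsingle : ∀ x : m → ℂ, x = ∑ i, x i • e i := fun x => by
    ext j; simp [e, Pi.single_apply]
  have hbil : ∀ z x v, dotProduct x ((M z).mulVec v) = (2 : ℂ)⁻¹ * (b z x v + b z v x) := by
    intro z x v
    conv_rhs => rw [hsingle x, hsingle v]
    simp only [map_sum, map_smul, _root_.sum_apply, _root_.smul_apply,
      smul_eq_mul, dotProduct, Matrix.mulVec, M, Mlin, Matrix.of_apply]
    have h3 : ∑ j, v j * ∑ i, x i * b z (e i) (e j) = ∑ i, x i * ∑ j, v j * b z (e i) (e j) := by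
      simp only [Finset.mul_sum]
      rw [Finset.sum_comm]
      exact Finset.sum_congr rfl fun i _ => Finset.sum_congr rfl fun j _ => by ring
    rw [h3, ← Finset.sum_add_distrib, Finset.mul_sum]
    refine Finset.sum_congr rfl fun i _ => ?_
    rw [← mul_add, ← Finset.sum_add_distrib, mul_left_comm, Finset.mul_sum, Finset.mul_sum,
      Finset.mul_sum]
    refine Finset.sum_congr rfl fun j _ => ?_
    ring
  have hdet : (M 0).det ≠ 0 := by
    intro h
    obtain ⟨u, hu, hMu⟩ := Matrix.exists_mulVec_eq_zero_iff.2 h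
    refine hu (h2 u ?_)
    ext v
    have h3 := hbil 0 v u
    rw [hMu, dotProduct_zero] at h3
    rw [hess, add_comm]
    simpa using h3.symm
  obtain ⟨B, hB, hBdet, hMB⟩ := Matrix.exists_analyticAt_eq_transpose_mul_self hM
    (Eventually.of_forall hMs) hdet
  let toCLM : Matrix m m ℂ → (m → ℂ) →L[ℂ] (m → ℂ) := fun A =>
    LinearMap.toContinuousLinearMap (Matrix.toLin' A)
  have htoCLM : ∀ A x, toCLM A x = A.mulVec x := fun A x => rfl
  refine ⟨fun z => toCLM (B z), AnalyticAt.comp (g := toCLM) (IsLinearMap.analyticAt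
    ⟨fun A A' => by ext1 x; simp [htoCLM, Matrix.add_mulVec],
      fun t A => by ext1 x; simp [htoCLM, Matrix.smul_mulVec]⟩ _) hB, ?_, ?_⟩
  · refine ⟨(Matrix.toLinearEquiv' (B 0) ((Matrix.isUnit_iff_isUnit_det _).2
      hBdet.isUnit).invertible).toContinuousLinearEquiv, ?_⟩
    ext1 x
    rfl
  · filter_upwards [hFb, hMB] with z h3 h4
    have h5 := hbil z z.2 z.2
    rw [h4, ← Matrix.mulVec_mulVec, Matrix.dotProduct_mulVec, Matrix.vecMul_transpose] at h5
    rw [h3]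
    simp only [htoCLM, pow_two]
    rw [dotProduct] at h5
    rw [h5]
    ring

end MorseBott

section Straightening

variable {Y X W : Type*} [NormedAddCommGroup Y] [NormedSpace ℂ Y] [NormedAddCommGroup X]
  [NormedSpace ℂ X] [NormedAddCommGroup W] [NormedSpace ℂ W]

theorem HasFDerivAt.exists_equiv_fst_prodMk {g : Y × X → W} {g' : Y × X →L[ℂ] W} {a : Y × X}
    (hg : HasFDerivAt g g' a) (A : X ≃L[ℂ] W)
    (hA : ∀ x, g' (0, x) = A x) :
    ∃ L : (Y × X) ≃L[ℂ] (Y × W), HasFDerivAt (fun z => (z.1, g z))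
      (L : (Y × X) →L[ℂ] (Y × W)) a := by
  refine ⟨(ContinuousLinearEquiv.refl ℂ Y).skewProd A (g'.comp (ContinuousLinearMap.inl ℂ Y X)),
    (hasFDerivAt_fst.prodMk hg).congr_fderiv ?_⟩
  refine ContinuousLinearMap.ext fun z => ?_
  have h : g' z = g' (z.1, 0) + g' (0, z.2) := by rw [← map_add]; simp
  simp [h, hA, add_comm]

/-- A function whose derivative vanishes near a point is locally constant there. -/
theorem eventually_eq_of_fderiv_eq_zero {φ : Y → ℂ} {a : Y}
    (hφ : ∀ᶠ y in 𝓝 a, HasFDerivAt φ (0 : Y →L[ℂ] ℂ) y) : ∀ᶠ y in 𝓝 a, φ y = φ a := by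
  obtain ⟨ε, hε, h⟩ := Metric.eventually_nhds_iff_ball.1 hφ
  filter_upwards [Metric.ball_mem_nhds a hε] with y hy
  exact Metric.isOpen_ball.is_const_of_fderiv_eq_zero (𝕜 := ℂ)
    (convex_ball a ε).isPreconnected (fun z hz => (h z hz).differentiableAt.differentiableWithinAt)
    (fun z hz => (h z hz).fderiv) hy (Metric.mem_ball_self hε)

variable [FiniteDimensional ℂ Y] [FiniteDimensional ℂ X]

theorem exists_equiv_dual_of_injective (A : X →L[ℂ] X →L[ℂ] ℂ) (hA : ∀ u, A u = 0 → u = 0) :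
    ∃ L : X ≃L[ℂ] (X →L[ℂ] ℂ), ∀ u, A u = L u := by
  have h : Module.finrank ℂ X = Module.finrank ℂ (X →L[ℂ] ℂ) := by
    rw [← LinearEquiv.finrank_eq (LinearMap.toContinuousLinearMap (𝕜 := ℂ) (E := X) (F' := ℂ))]
    exact (Subspace.dual_finrank_eq (K := ℂ) (V := X)).symm
  exact ⟨(LinearMap.linearEquivOfInjective (A : X →ₗ[ℂ] X →L[ℂ] ℂ)
    ((injective_iff_map_eq_zero _).2 hA) h).toContinuousLinearEquiv, fun u => rfl⟩

/-- Critical points of `F` along the fibres of `Y × X → Y` form an analytic graph if the fibre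
Hessian is nondegenerate. -/
theorem AnalyticAt.exists_critical_section {F : Y × X → ℂ} (hF : AnalyticAt ℂ F 0)
    (h1 : fderivSnd F 0 = 0) (h2 : ∀ x : X, fderiv ℂ (fderivSnd F) 0 (0, x) = 0 → x = 0) :
    ∃ u : Y → X, AnalyticAt ℂ u 0 ∧ u 0 = 0 ∧ ∀ᶠ y in 𝓝 0, fderivSnd F (y, u y) = 0 := by
  have : CompleteSpace Y := FiniteDimensional.complete ℂ Y
  have : CompleteSpace X := FiniteDimensional.complete ℂ X
  obtain ⟨A, hA⟩ := exists_equiv_dual_of_injective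
    ((fderiv ℂ (fderivSnd F) 0).comp (ContinuousLinearMap.inr ℂ Y X)) h2
  obtain ⟨L, hL⟩ := hF.fderivSnd.differentiableAt.hasFDerivAt.exists_equiv_fst_prodMk A hA
  obtain ⟨h, hh, h0, hs⟩ := (analyticAt_fst.prod hF.fderivSnd).exists_openPartialHomeomorph hL
  have hh' : ∀ z, h z = (z.1, fderivSnd F z) := fun z => congrFun hh z
  have hΦ0 : ((0 : Y × X).1, fderivSnd F 0) = (0 : Y × (X →L[ℂ] ℂ)) := by rw [h1]; rfl
  rw [hΦ0] at hs
  have h0t : (0 : Y × (X →L[ℂ] ℂ)) ∈ h.target := by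
    have := h.map_source h0
    rwa [hh', hΦ0] at this
  have hs0 : h.symm 0 = 0 := by
    have := h.left_inv h0
    rwa [hh', hΦ0] at this
  have hι : Tendsto (fun y : Y => (y, (0 : X →L[ℂ] ℂ))) (𝓝 0) (𝓝 0) :=
    (Continuous.prodMk_left (0 : X →L[ℂ] ℂ)).tendsto' _ _ rfl
  have hsι : AnalyticAt ℂ (fun y : Y => h.symm (y, 0)) 0 :=
    AnalyticAt.comp (g := h.symm) (f := fun y : Y => (y, (0 : X →L[ℂ] ℂ))) hs
      (analyticAt_id.prod analyticAt_const)
  refine ⟨fun y => (h.symm (y, 0)).2, analyticAt_snd.comp hsι, ?_, ?_⟩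
  · change (h.symm 0).2 = 0
    rw [hs0]; rfl
  · filter_upwards [hι (h.open_target.mem_nhds h0t)] with y hy
    have h3 := h.right_inv hy
    rw [hh', Prod.mk.injEq] at h3
    have h4 : (y, (h.symm (y, 0)).2) = h.symm (y, 0) := Prod.ext h3.1.symm rfl
    rw [h4, h3.2]

/-- The **Morse–Bott lemma**. -/
theorem AnalyticAt.exists_morseBott {m : Type*} [Fintype m] {F : Y × (m → ℂ) → ℂ}
    (hF : AnalyticAt ℂ F 0) (h0 : F 0 = 0) (h1 : fderivSnd F 0 = 0)
    (h2 : ∀ x : m → ℂ, fderiv ℂ (fderivSnd F) 0 (0, x) = 0 → x = 0)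
    (h3 : ∀ᶠ z in 𝓝 0, fderivSnd F z = 0 → fderiv ℂ F z = 0) :
    ∃ (ψ : Y × (m → ℂ) → Y × (m → ℂ)) (L : (Y × (m → ℂ)) ≃L[ℂ] (Y × (m → ℂ))),
      AnalyticAt ℂ ψ 0 ∧ ψ 0 = 0 ∧ HasFDerivAt ψ (L : Y × (m → ℂ) →L[ℂ] Y × (m → ℂ)) 0 ∧
      ∀ᶠ z in 𝓝 0, F z = ∑ i, (ψ z).2 i ^ 2 := by
  obtain ⟨u, hu, hu0, hFu⟩ := hF.exists_critical_section h1 h2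
  let τ : Y × (m → ℂ) → Y × (m → ℂ) := fun z => (z.1, u z.1 + z.2)
  have hu' : AnalyticAt ℂ (fun z : Y × (m → ℂ) => u z.1) 0 :=
    AnalyticAt.comp (g := u) (f := Prod.fst) hu analyticAt_fst
  have hτ : AnalyticAt ℂ τ 0 := analyticAt_fst.prod (hu'.add analyticAt_snd)
  have hτ0 : τ 0 = 0 := by simp [τ, hu0]
  have hτt : Tendsto τ (𝓝 0) (𝓝 0) := by simpa [hτ0] using hτ.continuousAt.tendsto
  have hγ : AnalyticAt ℂ (fun y : Y => (y, u y)) 0 := analyticAt_id.prod hu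
  have hγt : Tendsto (fun y : Y => (y, u y)) (𝓝 0) (𝓝 0) := by
    simpa [hu0, ← Prod.zero_eq_mk] using hγ.continuousAt.tendsto
  have hFτ : AnalyticAt ℂ (fun z => F (τ z)) 0 := AnalyticAt.comp (by rwa [hτ0]) hτ
  have hux : ∀ z : Y × (m → ℂ), DifferentiableAt ℂ u z.1 →
      ∀ x, fderiv ℂ (fun z : Y × (m → ℂ) => u z.1) z (0, x) = 0 := fun z hz x => by
    have h : fderiv ℂ (fun z : Y × (m → ℂ) => u z.1) z = _ :=
      (hz.hasFDerivAt.comp z hasFDerivAt_fst).fderiv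
    simp [h]
  have hfst : Tendsto (Prod.fst : Y × (m → ℂ) → Y) (𝓝 0) (𝓝 0) := continuous_fst.tendsto' _ _ rfl
  have hFγ : ∀ᶠ y in 𝓝 (0 : Y), F (y, u y) = 0 := by
    have h4 : ∀ᶠ y in 𝓝 (0 : Y), F (y, u y) = F (0, u 0) := by
      refine eventually_eq_of_fderiv_eq_zero (φ := fun y => F (y, u y)) ?_
      filter_upwards [hFu, hγt.eventually h3, hγt.eventually hF.eventually_analyticAt,
        hγ.eventually_analyticAt] with y h5 h6 h7 h8
      have h9 := h7.differentiableAt.hasFDerivAt.comp y h8.differentiableAt.hasFDerivAt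
      rwa [h6 h5, ContinuousLinearMap.zero_comp] at h9
    filter_upwards [h4] with y hy
    rw [hy, hu0]; exact h0
  have hsnd : fderivSnd (fun z => F (τ z)) =ᶠ[𝓝 0] fun z => fderivSnd F (τ z) := by
    filter_upwards [hτt.eventually hF.eventually_analyticAt, hu'.eventually_analyticAt,
      hfst.eventually hu.eventually_analyticAt] with z h4 h5 h8
    have h6 : HasFDerivAt τ _ z := hasFDerivAt_fst.prodMk
      (h5.differentiableAt.hasFDerivAt.add hasFDerivAt_snd)
    have h7 : fderiv ℂ (fun z => F (τ z)) z = _ :=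
      (h4.differentiableAt.hasFDerivAt.comp z h6).fderiv
    ext1 x
    simp [fderivSnd, h7, hux z h8.differentiableAt]
  obtain ⟨T, hT, ⟨A, hA⟩, hTF⟩ := hFτ.exists_eq_sum_sq
    (by filter_upwards [hFγ] with y hy; simpa [τ] using hy)
    (by
      have hι : Tendsto (fun y : Y => (y, (0 : m → ℂ))) (𝓝 0) (𝓝 0) :=
        (Continuous.prodMk_left (0 : m → ℂ)).tendsto' _ _ rfl
      filter_upwards [hι.eventually hsnd, hFu] with y h4 h5
      simpa [h4, τ] using h5)
    (by
      intro x hx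
      refine h2 x ?_
      have h4 : HasFDerivAt τ _ 0 := hasFDerivAt_fst.prodMk
        (hu'.differentiableAt.hasFDerivAt.add hasFDerivAt_snd)
      have h5 : AnalyticAt ℂ (fderivSnd F) (τ 0) := by rw [hτ0]; exact hF.fderivSnd
      have h6 : fderiv ℂ (fun z => fderivSnd F (τ z)) 0 = _ :=
        (h5.differentiableAt.hasFDerivAt.comp 0 h4).fderiv
      rw [hsnd.fderiv_eq, h6, hτ0] at hx
      simpa [hux 0 hu.differentiableAt] using hx)
  let ρ : Y × (m → ℂ) → Y × (m → ℂ) := fun z => (z.1, z.2 - u z.1)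
  have hρ : AnalyticAt ℂ ρ 0 := analyticAt_fst.prod (analyticAt_snd.sub hu')
  have hρ0 : ρ 0 = 0 := by simp [ρ, hu0]
  have hρt : Tendsto ρ (𝓝 0) (𝓝 0) := by simpa [hρ0] using hρ.continuousAt.tendsto
  have hTρ : AnalyticAt ℂ (fun z => T (ρ z)) 0 := AnalyticAt.comp (by rwa [hρ0]) hρ
  have hd : AnalyticAt ℂ (fun z : Y × (m → ℂ) => z.2 - u z.1) 0 := analyticAt_snd.sub hu'
  have hg : AnalyticAt ℂ (fun z => T (ρ z) (z.2 - u z.1)) 0 :=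
    AnalyticAt.comp (g := fun p : ((m → ℂ) →L[ℂ] (m → ℂ)) × (m → ℂ) => p.1 p.2)
      ((ContinuousLinearMap.id ℂ ((m → ℂ) →L[ℂ] (m → ℂ))).analyticAt_bilinear _) (hTρ.prod hd)
  obtain ⟨L, hL⟩ := (hTρ.differentiableAt.hasFDerivAt.clm_apply
    ((hasFDerivAt_snd (𝕜 := ℂ) (p := (0 : Y × (m → ℂ)))).sub
      hu'.differentiableAt.hasFDerivAt)).exists_equiv_fst_prodMk A fun x => by
        simp [hux 0 hu.differentiableAt, hρ0, hA, hu0]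
  refine ⟨_, L, analyticAt_fst.prod hg, by simp [hu0], hL, ?_⟩
  filter_upwards [hρt.eventually hTF] with z hz
  simpa [τ, ρ] using hz

end Straightening

/-- Coordinates in which `f` is a sum of squares up to a constant give an `A(d)` singularity. -/
theorem hasAdSingularityAt_of_eventually_eq {n d r : ℕ} {f : Cn n → ℂ} {x : Cn n}
    {ψ : Cn n → (Fin d → ℂ) × (Fin r → ℂ)} (hψ : AnalyticAt ℂ ψ x) (hψx : ψ x = 0)
    {L : Cn n ≃L[ℂ] (Fin d → ℂ) × (Fin r → ℂ)}
    (hL : HasFDerivAt ψ (L : Cn n →L[ℂ] (Fin d → ℂ) × (Fin r → ℂ)) x)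
    (hf : ∀ᶠ z in 𝓝 x, f z - f x = ∑ i, (ψ z).2 i ^ 2) : HasAdSingularityAt n d r f x := by
  obtain ⟨h, rfl, hx, hs⟩ := hψ.exists_openPartialHomeomorph hL
  rw [hψx] at hs
  obtain ⟨W₀, hW₀, hW₀o, hxW₀⟩ := eventually_nhds_iff.1 (hf.and hψ.eventually_analyticAt)
  obtain ⟨V₀, hV₀, hV₀o, h0V₀⟩ := eventually_nhds_iff.1 hs.eventually_analyticAt
  let W : Set (Cn n) := W₀ ∩ (h.source ∩ h ⁻¹' V₀)
  have hWo : IsOpen W := hW₀o.inter (h.isOpen_inter_preimage hV₀o)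
  have hxW : x ∈ W := ⟨hxW₀, hx, by simpa [hψx] using h0V₀⟩
  have hsx : h.symm 0 = x := by rw [← hψx, h.left_inv hx]
  refine ⟨h.target ∩ h.symm ⁻¹' W, W, h.symm, h, h.isOpen_inter_preimage_symm hWo, hWo, ?_, hxW,
    hsx, ?_, fun z hz => (hW₀ z hz.1).2, fun q hq => hq.2, fun z hz => ?_,
    fun q hq => h.right_inv hq.1, fun z hz => h.left_inv hz.2.1, fun q hq => ?_⟩
  · exact ⟨hψx ▸ h.map_source hx, by rwa [Set.mem_preimage, hsx]⟩
  · intro q hq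
    have h1 : h (h.symm q) ∈ V₀ := hq.2.2.2
    rw [h.right_inv hq.1] at h1
    exact hV₀ q h1
  · refine ⟨h.map_source hz.2.1, ?_⟩
    rwa [Set.mem_preimage, h.left_inv hz.2.1]
  · rw [(hW₀ _ hq.2.1).1, h.right_inv hq.1]

/-- The coordinate splitting of `ℂⁿ` attached to a set of `r` coordinates. -/
theorem exists_splitting {n d r : ℕ} (hdr : d + r = n) (S : Finset (Fin n)) (hS : S.card = r) :
    ∃ (Λ : ((Fin d → ℂ) × (Fin r → ℂ)) ≃L[ℂ] Cn n) (σ : Fin r ≃ S),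
      ∀ j, Λ (0, Pi.single j 1) = Pi.single (σ j : Fin n) 1 := by
  have hS' : Sᶜ.card = d := by rw [Finset.card_compl, Fintype.card_fin]; omega
  let e : Fin d ⊕ Fin r ≃ Fin n := (Equiv.sumComm _ _).trans (finSumEquivOfFinset hS hS')
  have he : ∀ j, e (Sum.inr j) = (S.orderIsoOfFin hS j : Fin n) := fun j => rfl
  refine ⟨((LinearEquiv.sumArrowLequivProdArrow (Fin d) (Fin r) ℂ ℂ).symm.trans
    (LinearEquiv.funCongrLeft ℂ ℂ e.symm)).toContinuousLinearEquiv,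
    (S.orderIsoOfFin hS).toEquiv, fun j => ?_⟩
  ext k
  obtain ⟨i, rfl⟩ := e.surjective k
  change (Sum.elim (0 : Fin d → ℂ) (Pi.single j 1) : Fin d ⊕ Fin r → ℂ) (e.symm (e i)) =
    (Pi.single (e (Sum.inr j)) 1 : Cn n) (e i)
  rw [Equiv.symm_apply_apply]
  rcases i with i | i <;> simp [Pi.single_apply]

theorem fderiv_eq_zero_of_pder_eq_zero {n : ℕ} {f : Cn n → ℂ} {z : Cn n} (h : ∀ k, pder f k z = 0) :
    fderiv ℂ f z = 0 := by
  refine ContinuousLinearMap.coe_injective (LinearMap.pi_ext' fun k => ?_)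
  ext
  exact h k

/-- A function whose jacobian ideal defines a reduced complete intersection of dimension `d` has
an `A(d)` singularity. -/
theorem hasAdSingularityAt_of_jacobianIdeal {n d r : ℕ} (hdr : d + r = n) {f : Cn n → ℂ}
    (hf : AnalyticAt ℂ f 0) (hf0 : f 0 = 0) {g : Fin r → Cn n → ℂ}
    (hg : ∀ i, AnalyticAt ℂ (g i) 0) (hg0 : ∀ i, g i 0 = 0)
    (hJ : jacobianIdeal f = idealOfFuns (Set.range g))
    (hred : IsReduced (On n ⧸ jacobianIdeal f))
    (hdim : ringKrullDim (On n ⧸ jacobianIdeal f) = d) : HasAdSingularityAt n d r f 0 := by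
  obtain ⟨S, hS, hSc, hdet⟩ := exists_det_hessian_ne_zero hdr hf hg hg0 hJ hred hdim
  obtain ⟨Λ, σ, hΛσ⟩ := exists_splitting hdr S hS
  have hΛ0 : Λ 0 = 0 := map_zero Λ
  have hΛt : Tendsto Λ (𝓝 0) (𝓝 0) := Λ.continuous.tendsto' _ _ hΛ0
  let F : (Fin d → ℂ) × (Fin r → ℂ) → ℂ := fun z => f (Λ z)
  have hF : AnalyticAt ℂ F 0 :=
    AnalyticAt.comp (by rwa [hΛ0]) (Λ.analyticAt 0)
  have hF' : ∀ z w, fderiv ℂ F z w = fderiv ℂ f (Λ z) (Λ w) := fun z w => by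
    have := Λ.comp_right_fderiv (f := f) (x := z)
    simp only [Function.comp_def] at this
    simp only [F]
    rw [this]; rfl
  have hFS : ∀ z j, fderivSnd F z (Pi.single j 1) = pder f (σ j) (Λ z) := fun z j => by
    simp [fderivSnd, hF', hΛσ, pder]
  obtain ⟨ψ, L, hψ, hψ0, hL, hFψ⟩ := hF.exists_morseBott (by simpa [F] using hf0)
    (by
      refine ContinuousLinearMap.coe_injective (LinearMap.pi_ext' fun j => ?_)
      ext
      have := hFS 0 j
      rwa [hΛ0, pder_eq_zero_of_jacobianIdeal_eq hf hg hg0 hJ] at this)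
    (by
      intro x hx
      have hH := hdet
      rw [← Matrix.det_submatrix_equiv_self σ] at hH
      refine Matrix.eq_zero_of_vecMul_eq_zero hH ?_
      ext j
      have h1 : HasFDerivAt (fun z => fderivSnd F z (Pi.single j 1)) _ 0 :=
        hF.fderivSnd.differentiableAt.hasFDerivAt.clm_apply (hasFDerivAt_const _ _)
      have h2 : AnalyticAt ℂ (pder f (σ j)) (Λ 0) := by rw [hΛ0]; exact hf.pder _
      have h3 : HasFDerivAt (fun z => fderivSnd F z (Pi.single j 1)) _ 0 :=
        (h2.differentiableAt.hasFDerivAt.comp 0 Λ.hasFDerivAt).congr_of_eventuallyEq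
          (Eventually.of_forall fun z => hFS z j)
      have h4 := congrArg (fun A => A (0, x)) (h1.unique h3)
      have h5 : Λ (0, x) = ∑ i, x i • (Pi.single (σ i : Fin n) 1 : Cn n) := by
        simp only [← hΛσ, ← map_smul, ← map_sum]
        congr 1
        refine Prod.ext (by simp [Prod.fst_sum]) ?_
        ext i
        simp [Prod.snd_sum, Pi.single_apply]
      simp only [ContinuousLinearMap.comp_zero, zero_add, ContinuousLinearMap.flip_apply, hx,
        _root_.zero_apply, ContinuousLinearMap.comp_apply, ContinuousLinearEquiv.coe_coe, h5,
        hΛ0, map_sum, map_smul, smul_eq_mul] at h4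
      exact h4.symm)
    (by
      filter_upwards [hΛt.eventually (eventually_all.2 fun k => (hSc k).choose_spec)] with z hz h0
      refine ContinuousLinearMap.ext fun w => ?_
      rw [hF', fderiv_eq_zero_of_pder_eq_zero fun k => ?_]
      · rfl
      · rw [hz k]
        refine Finset.sum_eq_zero fun l _ => ?_
        have := hFS z (σ.symm l)
        rw [h0, Equiv.apply_symm_apply] at this
        rw [← this]; simp)
  have hΛst : Tendsto Λ.symm (𝓝 0) (𝓝 0) := Λ.symm.continuous.tendsto' _ _ (map_zero _)
  refine hasAdSingularityAt_of_eventually_eq (ψ := fun z => ψ (Λ.symm z)) (L := Λ.symm.trans L)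
    (AnalyticAt.comp (by rwa [map_zero]) (Λ.symm.analyticAt 0)) (by simpa using hψ0)
    ?_ ?_
  · exact HasFDerivAt.comp (g := ψ) (f := Λ.symm) (0 : Cn n) (by rwa [map_zero])
      Λ.symm.hasFDerivAt
  · filter_upwards [hΛst.eventually hFψ] with z hz
    rw [← hz, hf0, sub_zero]
    simp [F]

/-- **Lemma 4.4.** Suppose `f : ℂⁿ⁺¹ → ℂ` is holomorphic near `0` with
`f 0 = 0`, and `I = (g₁, …, g_r)` (with `r = n + 1 - d`) defines a complete
intersection `Σ^d` at `0` with reduced structure, and `J(f) = I`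
(i.e. `j(f) = 0`).  Then `f` has a singularity of type `A(d)` at `0`. -/
theorem lemma_4_4 (n d : ℕ) (hd : d ≤ n) (r : ℕ) (hr : r = n + 1 - d)
    (U : Set (Cn (n + 1))) (hU : IsOpen U) (h0U : (0 : Cn (n + 1)) ∈ U)
    (f : Cn (n + 1) → ℂ) (hf : AnalyticOnNhd ℂ f U) (hf0 : f 0 = 0)
    (g : Fin r → Cn (n + 1) → ℂ) (hg : ∀ i, AnalyticOnNhd ℂ (g i) U)
    (hg0 : ∀ i, g i 0 = 0)
    (I : Ideal (On (n + 1))) (hI : I = idealOfFuns (Set.range g))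
    (hred : IsReduced ((On (n + 1)) ⧸ I))
    (hdim : ringKrullDim ((On (n + 1)) ⧸ I) = d)
    (hJf : jacobianIdeal f = I) :
    HasAdSingularityAt (n + 1) d r f 0 := by
  subst hI
  rw [← hJf] at hred hdim
  exact hasAdSingularityAt_of_jacobianIdeal (by omega) (hf 0 h0U) hf0 (fun i => hg i 0 h0U) hg0 hJf
    hred hdim

end
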